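/- Let N ≥ 1 be an integer, q ∈ (1, ∞), σ ∈ (0, π/2), and ρ > 0. There exists a constant C = C(N, q, σ, ρ) > 0 such that for every λ ∈ ℂ with λ ≠ 0 and |arg λ| < π − σ, and every Schwartz vector field F ∈ 𝓢(ℝ^N; ℂ^N), the function V(x) = −(2π)^{−N} ∫_{ℝ^N} e^{i x·ξ} (i ξ · 𝓕F(ξ)) / (ρλ + ‖ξ‖²) dξ is a well-defined Schwartz function satisfying ρλ V(x) − ΔV(x) = −div F(x) for all x ∈ ℝ^N, together with the estimates |λ|^{1/2} ‖V‖_{L^q(ℝ^N)} + ‖∇V‖_{L^q(ℝ^N)} ≤ C ‖F‖_{L^q(ℝ^N)} and |λ| ‖V‖_{L^q(ℝ^N)} + |λ|^{1/2} ‖∇V‖_{L^q(ℝ^N)} + ‖D²V‖_{L^q(ℝ^N)} ≤ C ‖div F‖_{L^q(ℝ^N)}, with C independent of λ and F. -/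

import Mathlib

open Real MeasureTheory
open scoped RealInnerProductSpace

/-- The `L^p` norm (real exponent `p`) of `f` with respect to the measure `μ`. -/
noncomputable def LqNorm {α : Type*} [MeasurableSpace α] {E : Type*} [NormedAddCommGroup E]
    (μ : Measure α) (p : ℝ) (f : α → E) : ℝ :=
  (∫ x, ‖f x‖ ^ p ∂μ) ^ (1 / p)

/-- The algebraic inequality behind the strong convexity of the Bellman function: all powers of
`a`, `b` and `a ^ (p / 2) + b ^ (q / 2)` enter as atoms. -/
lemma bellman_hessian_ge {p q θ a b u v x y g2 g1 H α1 α2 β1 β2 A : ℝ}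
    (hp : 2 ≤ p) (hq : 1 < q) (hq2 : q ≤ 2) (hθ0 : 0 ≤ θ) (hθ1 : θ ≤ 1) (hθp : (1 - θ) * p = 2)
    (ha : 0 < a) (hb : 0 < b) (hu : u ^ 2 ≤ a) (hv : v ^ 2 ≤ b)
    (hg2 : 0 < g2) (hg1 : 0 < g1) (hH : 0 < H)
    (hα1 : 0 < α1) (hα2 : 0 < α2) (hβ1 : 0 < β1) (hβ2 : 0 < β2)
    (hβ12 : b * β2 = β1)
    (hαg : a * α1 * g2 ≤ g1) (hβg : b * β1 * g2 ≤ g1)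
    (hag : a * g1 ≤ 1) (hgβ : g1 * (b * β1) * β1 ≤ 1) (hHβ : 1 ≤ H * β1)
    (hA : A * (q * (q - 1)) = q ^ 2 + 41) :
    2 * |x * y| ≤ A * (q * β1 * y ^ 2 + q * (q - 2) * β2 * v ^ 2 * y ^ 2) + 2 * x ^ 2 * H
      + 4 * (u * x) * (θ * g1 * (p * α1 * (u * x) + q * β1 * (v * y)))
      + a * (θ * g1 * ((p * α1 * x ^ 2 + p * (p - 2) * α2 * u ^ 2 * x ^ 2)
          + (q * β1 * y ^ 2 + q * (q - 2) * β2 * v ^ 2 * y ^ 2))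
        + θ * (θ - 1) * g2 * (p * α1 * (u * x) + q * β1 * (v * y)) ^ 2) := by
  have hA0 : 0 < A := by
    have h1 : 0 < q * (q - 1) := by nlinarith
    by_contra h
    nlinarith [mul_nonneg (neg_nonneg.2 (not_lt.1 h)) h1.le]
  -- the second derivative of `b ^ (q / 2)`
  have hβ : q * (q - 1) * β1 * y ^ 2 ≤
      q * β1 * y ^ 2 + q * (q - 2) * β2 * v ^ 2 * y ^ 2 := by
    have h1 : β2 * v ^ 2 ≤ β1 := by rw [← hβ12, mul_comm b]; gcongr
    have h2 : 0 ≤ q * (2 - q) * y ^ 2 := by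
      have : 0 ≤ 2 - q := by linarith
      positivity
    nlinarith [mul_le_mul_of_nonneg_left h1 h2]
  have hβ0 : 0 ≤ q * (q - 1) * β1 * y ^ 2 := by
    have : 0 ≤ q - 1 := by linarith
    positivity
  have hα : 0 ≤ p * α1 * x ^ 2 + p * (p - 2) * α2 * u ^ 2 * x ^ 2 := by
    have : 0 ≤ p - 2 := by linarith
    positivity
  -- the mixed terms
  have hc1 : |u * v * (g1 * β1)| ≤ 1 := by
    rw [← sq_le_one_iff_abs_le_one]
    calc (u * v * (g1 * β1)) ^ 2 = u ^ 2 * v ^ 2 * (g1 * β1) ^ 2 := by ring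
      _ ≤ a * b * (g1 * β1) ^ 2 := by gcongr
      _ = (a * g1) * (g1 * (b * β1) * β1) := by ring
      _ ≤ 1 * 1 := by gcongr
      _ = 1 := by ring
  have hc2 : |u * v * (a * g2 * α1 * β1)| ≤ 1 := by
    rw [← sq_le_one_iff_abs_le_one]
    calc (u * v * (a * g2 * α1 * β1)) ^ 2 = u ^ 2 * v ^ 2 * (a * g2 * α1 * β1) ^ 2 := by ring
      _ ≤ a * b * (a * g2 * α1 * β1) ^ 2 := by gcongr
      _ = a * b * (a * α1 * g2) ^ 2 * β1 ^ 2 := by ring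
      _ ≤ a * b * g1 ^ 2 * β1 ^ 2 := by gcongr
      _ = (a * g1) * (g1 * (b * β1) * β1) := by ring
      _ ≤ 1 * 1 := by gcongr
      _ = 1 := by ring
  have hθq : 0 ≤ 4 * θ * q := by positivity
  have hθq' : 4 * θ * q ≤ 8 := by nlinarith
  have hm1 : -(8 * |x * y|) ≤ 4 * θ * q * (u * v * (g1 * β1) * (x * y)) := by
    have h1 : |4 * θ * q * (u * v * (g1 * β1) * (x * y))| ≤ 8 * |x * y| := by
      rw [abs_mul, abs_mul _ (x * y), abs_of_nonneg hθq]
      calc 4 * θ * q * (|u * v * (g1 * β1)| * |x * y|) ≤ 8 * (1 * |x * y|) := by gcongr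
        _ = _ := by ring
    exact (abs_le.1 h1).1
  have hm2 : -(8 * |x * y|) ≤ -(4 * θ * q * (u * v * (a * g2 * α1 * β1) * (x * y))) := by
    have h1 : |4 * θ * q * (u * v * (a * g2 * α1 * β1) * (x * y))| ≤ 8 * |x * y| := by
      rw [abs_mul, abs_mul _ (x * y), abs_of_nonneg hθq]
      calc 4 * θ * q * (|u * v * (a * g2 * α1 * β1)| * |x * y|) ≤ 8 * (1 * |x * y|) := by gcongr
        _ = _ := by ring
    linarith [(abs_le.1 h1).2]
  -- the square terms coming from the concavity of the outer power
  have hs1 : a * (θ * ((1 - θ) * p) * p * g2 * (α1 * (u * x)) ^ 2) ≤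
      4 * p * θ * g1 * α1 * (u * x) ^ 2 := by
    rw [hθp]
    have : a * α1 * g2 * (θ * 2 * p * α1 * (u * x) ^ 2) ≤ g1 * (θ * 2 * p * α1 * (u * x) ^ 2) := by
      gcongr
    have h0 : 0 ≤ g1 * (θ * 2 * p * α1 * (u * x) ^ 2) := by positivity
    linarith
  have hs2 : a * (θ * (1 - θ) * g2 * (q * β1 * (v * y)) ^ 2) ≤ q ^ 2 * β1 * y ^ 2 := by
    have h1θ : 0 ≤ 1 - θ := by linarith
    calc a * (θ * (1 - θ) * g2 * (q * β1 * (v * y)) ^ 2)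
        = (θ * (1 - θ)) * (a * g2 * (q ^ 2 * β1 ^ 2 * y ^ 2) * v ^ 2) := by ring
      _ ≤ 1 * (a * g2 * (q ^ 2 * β1 ^ 2 * y ^ 2) * b) := by
          gcongr
          nlinarith
      _ = a * (b * β1 * g2) * (q ^ 2 * β1 * y ^ 2) := by ring
      _ ≤ a * g1 * (q ^ 2 * β1 * y ^ 2) := by gcongr
      _ ≤ 1 * (q ^ 2 * β1 * y ^ 2) := by gcongr
      _ = _ := by ring
  have hs3 : 18 * |x * y| ≤ 2 * x ^ 2 * H + 41 * β1 * y ^ 2 := by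
    have h1 : (x * y) ^ 2 * 1 ≤ (x * y) ^ 2 * (H * β1) := by gcongr
    have h2 : (18 * |x * y|) ^ 2 ≤ (2 * x ^ 2 * H + 41 * β1 * y ^ 2) ^ 2 := by
      rw [mul_pow, sq_abs]
      calc 18 ^ 2 * (x * y) ^ 2 ≤ 4 * (82 * ((x * y) ^ 2 * (H * β1))) := by
            linarith [sq_nonneg (x * y)]
        _ = 4 * (2 * x ^ 2 * H) * (41 * β1 * y ^ 2) := by ring
        _ ≤ _ := four_mul_le_sq_add _ _
    exact le_of_sq_le_sq h2 (by positivity)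
  have hβA : (q ^ 2 + 41) * β1 * y ^ 2 ≤
      A * (q * β1 * y ^ 2 + q * (q - 2) * β2 * v ^ 2 * y ^ 2) := by
    calc (q ^ 2 + 41) * β1 * y ^ 2 = A * (q * (q - 1) * β1 * y ^ 2) := by rw [← hA]; ring
      _ ≤ _ := by gcongr
  have hT3 : 0 ≤ a * (θ * g1 * ((p * α1 * x ^ 2 + p * (p - 2) * α2 * u ^ 2 * x ^ 2)
          + (q * β1 * y ^ 2 + q * (q - 2) * β2 * v ^ 2 * y ^ 2))) := by
    have : 0 ≤ q * β1 * y ^ 2 + q * (q - 2) * β2 * v ^ 2 * y ^ 2 := hβ0.trans hβ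
    positivity
  have hcross : a * (θ * (1 - θ) * g2 * (2 * (p * α1 * (u * x)) * (q * β1 * (v * y)))) =
      4 * θ * q * (u * v * (a * g2 * α1 * β1) * (x * y)) := by
    linear_combination (2 * a * θ * g2 * α1 * u * x * q * β1 * v * y) * hθp
  have hid : 4 * (u * x) * (θ * g1 * (p * α1 * (u * x) + q * β1 * (v * y)))
      + a * (θ * g1 * ((p * α1 * x ^ 2 + p * (p - 2) * α2 * u ^ 2 * x ^ 2)
          + (q * β1 * y ^ 2 + q * (q - 2) * β2 * v ^ 2 * y ^ 2))
        + θ * (θ - 1) * g2 * (p * α1 * (u * x) + q * β1 * (v * y)) ^ 2)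
      = 4 * p * θ * g1 * α1 * (u * x) ^ 2 + 4 * θ * q * (u * v * (g1 * β1) * (x * y))
        + a * (θ * g1 * ((p * α1 * x ^ 2 + p * (p - 2) * α2 * u ^ 2 * x ^ 2)
          + (q * β1 * y ^ 2 + q * (q - 2) * β2 * v ^ 2 * y ^ 2)))
        - a * (θ * ((1 - θ) * p) * p * g2 * (α1 * (u * x)) ^ 2)
        - a * (θ * (1 - θ) * g2 * (2 * (p * α1 * (u * x)) * (q * β1 * (v * y))))
        - a * (θ * (1 - θ) * g2 * (q * β1 * (v * y)) ^ 2) := by ring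
  linarith

lemma hasDerivAt_line_sq_add (ζ x ε t : ℝ) :
    HasDerivAt (fun t : ℝ => (ζ + t * x) ^ 2 + ε) (2 * ((ζ + t * x) * x)) t := by
  have h : HasDerivAt (fun t : ℝ => ζ + t * x) x t := by
    simpa using ((hasDerivAt_id t).mul_const x).const_add ζ
  simpa [mul_assoc] using (h.pow 2).add_const ε

lemma hasDerivAt_line_sq_add_rpow (ζ x t : ℝ) {ε : ℝ} (hε : 0 < ε) (s : ℝ) :
    HasDerivAt (fun t : ℝ => ((ζ + t * x) ^ 2 + ε) ^ s)
      (2 * s * ((ζ + t * x) ^ 2 + ε) ^ (s - 1) * ((ζ + t * x) * x)) t := by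
  have h := (hasDerivAt_line_sq_add ζ x ε t).rpow_const (p := s) (Or.inl (by positivity))
  exact h.congr_deriv (by ring)

lemma hasDerivAt_line_sq_add_rpow_deriv (ζ x t : ℝ) {ε : ℝ} (hε : 0 < ε) (r : ℝ) :
    HasDerivAt (fun t : ℝ => r * ((ζ + t * x) ^ 2 + ε) ^ (r / 2 - 1) * ((ζ + t * x) * x))
      (r * ((ζ + t * x) ^ 2 + ε) ^ (r / 2 - 1) * x ^ 2
        + r * (r - 2) * ((ζ + t * x) ^ 2 + ε) ^ (r / 2 - 2) * (ζ + t * x) ^ 2 * x ^ 2) t := by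
  have h : HasDerivAt (fun t : ℝ => (ζ + t * x) * x) (x * x) t := by
    simpa using (((hasDerivAt_id t).mul_const x).const_add ζ).mul_const x
  have h2 := ((hasDerivAt_line_sq_add_rpow ζ x t hε (r / 2 - 1)).const_mul r).mul h
  refine h2.congr_deriv ?_
  rw [show r / 2 - 1 - 1 = r / 2 - 2 by ring]
  ring

/-- A regularised Bellman function for the `L^p`-`L^q` duality. -/
noncomputable def bellmanReg (p q A ε ζ η : ℝ) : ℝ :=
  A * (η ^ 2 + ε) ^ (q / 2)
    + (ζ ^ 2 + ε) * ((ζ ^ 2 + ε) ^ (p / 2) + (η ^ 2 + ε) ^ (q / 2)) ^ (1 - 2 / p)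

lemma bellmanReg_midpoint {p q A ε : ℝ} (hp : 2 ≤ p) (hq : 1 < q) (hpq : 1 / p + 1 / q = 1)
    (hA : A * (q * (q - 1)) = q ^ 2 + 41) (hε : 0 < ε) (ζ η x y : ℝ) :
    2 * bellmanReg p q A ε ζ η + 2 * |x * y| ≤
      bellmanReg p q A ε (ζ + x) (η + y) + bellmanReg p q A ε (ζ - x) (η - y) := by
  have hp0 : 0 < p := by linarith
  have hq0 : 0 < q := by linarith
  have hip : 1 / p ≤ 1 / 2 := by gcongr
  have hip0 : 0 < 1 / p := by positivity
  have hq2 : q ≤ 2 := by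
    have h1 : 1 / 2 ≤ 1 / q := by linarith
    exact (one_div_le_one_div (by norm_num) hq0).1 h1
  set θ : ℝ := 1 - 2 / p with hθ
  have h2p : 2 / p = 2 * (1 / p) := by ring
  have hθ0 : 0 ≤ θ := by rw [hθ, h2p]; linarith
  have hθ1 : θ ≤ 1 := by rw [hθ, h2p]; linarith
  have hθp : (1 - θ) * p = 2 := by rw [hθ]; field_simp; ring
  let a : ℝ → ℝ := fun t => (ζ + t * x) ^ 2 + ε
  let b : ℝ → ℝ := fun t => (η + t * y) ^ 2 + ε
  let α' : ℝ → ℝ := fun t => p * a t ^ (p / 2 - 1) * ((ζ + t * x) * x)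
  let β' : ℝ → ℝ := fun t => q * b t ^ (q / 2 - 1) * ((η + t * y) * y)
  let α'' : ℝ → ℝ := fun t => p * a t ^ (p / 2 - 1) * x ^ 2
        + p * (p - 2) * a t ^ (p / 2 - 2) * (ζ + t * x) ^ 2 * x ^ 2
  let β'' : ℝ → ℝ := fun t => q * b t ^ (q / 2 - 1) * y ^ 2
        + q * (q - 2) * b t ^ (q / 2 - 2) * (η + t * y) ^ 2 * y ^ 2
  let G : ℝ → ℝ := fun t => a t ^ (p / 2) + b t ^ (q / 2)
  have ha0 : ∀ t, 0 < a t := fun t => by positivity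
  have hb0 : ∀ t, 0 < b t := fun t => by positivity
  have hα : ∀ t, HasDerivAt (fun t => a t ^ (p / 2)) (α' t) t := fun t =>
    (hasDerivAt_line_sq_add_rpow ζ x t hε (p / 2)).congr_deriv (by simp only [α', a]; ring)
  have hβ : ∀ t, HasDerivAt (fun t => b t ^ (q / 2)) (β' t) t := fun t =>
    (hasDerivAt_line_sq_add_rpow η y t hε (q / 2)).congr_deriv (by simp only [β', b]; ring)
  have hα2 : ∀ t, HasDerivAt α' (α'' t) t := fun t =>
    hasDerivAt_line_sq_add_rpow_deriv ζ x t hε p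
  have hβ2 : ∀ t, HasDerivAt β' (β'' t) t := fun t =>
    hasDerivAt_line_sq_add_rpow_deriv η y t hε q
  have hG0 : ∀ t, 0 < G t := fun t =>
    add_pos (rpow_pos_of_pos (ha0 t) _) (rpow_pos_of_pos (hb0 t) _)
  have hG : ∀ t, HasDerivAt G (α' t + β' t) t := fun t => (hα t).add (hβ t)
  have ha : ∀ t, HasDerivAt a (2 * ((ζ + t * x) * x)) t := hasDerivAt_line_sq_add ζ x ε
  have hax : ∀ t, HasDerivAt (fun t : ℝ => 2 * ((ζ + t * x) * x)) (2 * x ^ 2) t := fun t =>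
    (((((hasDerivAt_id t).mul_const x).const_add ζ).mul_const x).const_mul 2).congr_deriv
      (by ring)
  have hGp : ∀ s t, HasDerivAt (fun t => G t ^ s) (s * G t ^ (s - 1) * (α' t + β' t)) t :=
    fun s t => ((hG t).rpow_const (Or.inl (hG0 t).ne')).congr_deriv (by ring)
  let g : ℝ → ℝ := fun t => A * b t ^ (q / 2) + a t * G t ^ θ - |x * y| * t ^ 2
  let g' : ℝ → ℝ := fun t => A * β' t + ((2 * ((ζ + t * x) * x)) * G t ^ θ
      + a t * (θ * G t ^ (θ - 1) * (α' t + β' t))) - |x * y| * (2 * t)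
  let g'' : ℝ → ℝ := fun t => A * β'' t + (((2 * x ^ 2) * G t ^ θ
      + (2 * ((ζ + t * x) * x)) * (θ * G t ^ (θ - 1) * (α' t + β' t)))
      + ((2 * ((ζ + t * x) * x)) * (θ * G t ^ (θ - 1) * (α' t + β' t))
      + a t * (θ * ((θ - 1) * G t ^ (θ - 1 - 1) * (α' t + β' t)) * (α' t + β' t)
        + θ * G t ^ (θ - 1) * (α'' t + β'' t)))) - |x * y| * 2
  have hg : ∀ t, HasDerivAt g (g' t) t := fun t => by
    refine (((hβ t).const_mul A).add ((ha t).mul (hGp θ t))).sub ?_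
    exact ((hasDerivAt_pow 2 t).const_mul |x * y|).congr_deriv (by simp)
  have hg' : ∀ t, HasDerivAt g' (g'' t) t := fun t => by
    refine (((hβ2 t).const_mul A).add (((hax t).mul (hGp θ t)).add ((ha t).mul
      (((hGp (θ - 1) t).const_mul θ).mul ((hα2 t).add (hβ2 t)))))).sub ?_
    exact (((hasDerivAt_id t).const_mul 2).const_mul |x * y|).congr_deriv (by simp)
  have hg''0 : ∀ t, 0 ≤ g'' t := by
    intro t
    have hsplit : ∀ {c : ℝ}, 0 < c → ∀ s : ℝ, c * c ^ (s - 1) = c ^ s := fun {c} hc s => by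
      rw [rpow_sub_one hc.ne']; field_simp
    have hαG : a t ^ (p / 2) ≤ G t := le_add_of_nonneg_right (rpow_pos_of_pos (hb0 t) _).le
    have hβG : b t ^ (q / 2) ≤ G t := le_add_of_nonneg_left (rpow_pos_of_pos (ha0 t) _).le
    have haG : a t ≤ G t ^ (2 / p) := by
      calc a t = (a t ^ (p / 2)) ^ (2 / p) := by
            rw [← rpow_mul (ha0 t).le, show p / 2 * (2 / p) = 1 by field_simp, rpow_one]
        _ ≤ _ := by gcongr
    have hbG : ∀ s, 0 ≤ s → (b t) ^ s ≤ G t ^ (s * (2 / q)) := fun s hs => by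
      calc b t ^ s = (b t ^ (q / 2)) ^ (s * (2 / q)) := by
            rw [← rpow_mul (hb0 t).le]; congr 1; field_simp
        _ ≤ _ := by gcongr
    have h2q : 2 / q = 2 * (1 / q) := by ring
    have key := bellman_hessian_ge (p := p) (q := q) (θ := θ) (a := a t) (b := b t)
      (u := ζ + t * x) (v := η + t * y) (x := x) (y := y) (g2 := G t ^ (θ - 1 - 1))
      (g1 := G t ^ (θ - 1)) (H := G t ^ θ) (α1 := a t ^ (p / 2 - 1)) (α2 := a t ^ (p / 2 - 2))
      (β1 := b t ^ (q / 2 - 1)) (β2 := b t ^ (q / 2 - 2)) (A := A)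
      hp hq hq2 hθ0 hθ1 hθp (ha0 t) (hb0 t) (by simp only [a]; linarith)
      (by simp only [b]; linarith) (rpow_pos_of_pos (hG0 t) _) (rpow_pos_of_pos (hG0 t) _)
      (rpow_pos_of_pos (hG0 t) _) (rpow_pos_of_pos (ha0 t) _) (rpow_pos_of_pos (ha0 t) _)
      (rpow_pos_of_pos (hb0 t) _) (rpow_pos_of_pos (hb0 t) _)
      (by rw [← hsplit (hb0 t) (q / 2 - 1), show q / 2 - 1 - 1 = q / 2 - 2 by ring])
      (by
        rw [hsplit (ha0 t), ← hsplit (hG0 t) (θ - 1)]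
        gcongr)
      (by
        rw [hsplit (hb0 t), ← hsplit (hG0 t) (θ - 1)]
        gcongr)
      (by
        calc a t * G t ^ (θ - 1) ≤ G t ^ (2 / p) * G t ^ (θ - 1) := by
              gcongr
          _ = 1 := by
              rw [← rpow_add (hG0 t), show 2 / p + (θ - 1) = 0 by rw [hθ]; ring, rpow_zero])
      (by
        rw [hsplit (hb0 t), mul_assoc, ← rpow_add (hb0 t)]
        calc G t ^ (θ - 1) * b t ^ (q / 2 + (q / 2 - 1))
            ≤ G t ^ (θ - 1) * G t ^ ((q / 2 + (q / 2 - 1)) * (2 / q)) := by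
              gcongr
              exact hbG _ (by linarith)
          _ = 1 := by
              rw [← rpow_add (hG0 t)]
              have : (q / 2 + (q / 2 - 1)) * (2 / q) = 2 - 2 * (1 / q) := by field_simp; ring
              rw [this, show θ - 1 + (2 - 2 * (1 / q)) = 0 by rw [hθ, h2p]; linarith, rpow_zero])
      (by
        have h1 := hbG (1 - q / 2) (by linarith)
        have h2 : (1 - q / 2) * (2 / q) = θ := by
          have : (1 - q / 2) * (2 / q) = 2 * (1 / q) - 1 := by field_simp
          rw [this, hθ, h2p]; linarith
        rw [h2] at h1
        calc (1 : ℝ) = b t ^ (1 - q / 2) * b t ^ (q / 2 - 1) := by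
              rw [← rpow_add (hb0 t)]; simp
          _ ≤ _ := by
              gcongr)
      hA
    have e : g'' t = A * β'' t + 2 * x ^ 2 * G t ^ θ
        + 4 * ((ζ + t * x) * x) * (θ * G t ^ (θ - 1) * (α' t + β' t))
        + a t * (θ * G t ^ (θ - 1) * (α'' t + β'' t)
        + θ * (θ - 1) * G t ^ (θ - 1 - 1) * (α' t + β' t) ^ 2) - 2 * |x * y| := by
      simp only [g'']; ring
    rw [e]
    exact sub_nonneg.2 key
  have hconv : ConvexOn ℝ Set.univ g := by
    refine convexOn_of_hasDerivWithinAt2_nonneg convex_univ (f' := g') (f'' := g'')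
      (fun t _ => (hg t).continuousAt.continuousWithinAt) ?_ ?_ ?_
    · intro t _; exact (hg t).hasDerivWithinAt
    · intro t _; exact (hg' t).hasDerivWithinAt
    · intro t _; exact hg''0 t
  have h := hconv.2 (Set.mem_univ 1) (Set.mem_univ (-1))
    (show (0 : ℝ) ≤ 1 / 2 by norm_num) (show (0 : ℝ) ≤ 1 / 2 by norm_num) (by norm_num)
  have h0 : (1 / 2 : ℝ) • (1 : ℝ) + (1 / 2 : ℝ) • (-1 : ℝ) = 0 := by norm_num
  rw [h0] at h
  have e0 : g 0 = bellmanReg p q A ε ζ η := by simp [g, bellmanReg, a, b, G, hθ]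
  have e1 : g 1 = bellmanReg p q A ε (ζ + x) (η + y) - |x * y| := by
    simp [g, bellmanReg, a, b, G, hθ]
  have e2 : g (-1) = bellmanReg p q A ε (ζ - x) (η - y) - |x * y| := by
    simp [g, bellmanReg, a, b, G, hθ, sub_eq_add_neg]
  rw [e0, e1, e2] at h
  simp only [smul_eq_mul] at h
  linarith

/-- A Bellman function for the `L^p`-`L^q` duality. -/
noncomputable def bellman (p q ζ η : ℝ) : ℝ :=
  bellmanReg p q ((q ^ 2 + 41) / (q * (q - 1))) 0 ζ η

lemma bellman_eq (p q ζ η : ℝ) : bellman p q ζ η =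
    (q ^ 2 + 41) / (q * (q - 1)) * |η| ^ q + |ζ| ^ 2 * (|ζ| ^ p + |η| ^ q) ^ (1 - 2 / p) := by
  have h : ∀ c s : ℝ, (c ^ 2) ^ (s / 2) = |c| ^ s := fun c s => by
    rw [← sq_abs, ← rpow_natCast, ← rpow_mul (abs_nonneg c)]; congr 1; push_cast; ring
  simp only [bellman, bellmanReg, add_zero, h, sq_abs]

lemma bellman_nonneg {p q : ℝ} (hq : 1 < q) (ζ η : ℝ) : 0 ≤ bellman p q ζ η := by
  have : 0 < q - 1 := by linarith
  have : 0 < q := by linarith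
  rw [bellman_eq]
  positivity

lemma bellman_le {p q : ℝ} (hp : 2 ≤ p) (hq : 1 < q) (ζ η : ℝ) :
    bellman p q ζ η ≤ ((q ^ 2 + 41) / (q * (q - 1)) + 1) * (|ζ| ^ p + |η| ^ q) := by
  have hq1 : 0 < q - 1 := by linarith
  have hq0 : 0 < q := by linarith
  have hp0 : 0 < p := by linarith
  have hθ0 : 0 ≤ 1 - 2 / p := by
    rw [sub_nonneg, div_le_one hp0]; exact hp
  rw [bellman_eq, add_mul, one_mul]
  gcongr ?_ + ?_
  · gcongr
    exact le_add_of_nonneg_left (by positivity)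
  · have hG : 0 ≤ |ζ| ^ p + |η| ^ q := by positivity
    have h1 : |ζ| ^ 2 ≤ (|ζ| ^ p + |η| ^ q) ^ (2 / p) := by
      calc |ζ| ^ 2 = (|ζ| ^ p) ^ (2 / p) := by
            rw [← rpow_mul (abs_nonneg ζ), ← rpow_natCast]; congr 1; field_simp; norm_num
        _ ≤ _ := by
            gcongr
            exact le_add_of_nonneg_right (by positivity)
    calc |ζ| ^ 2 * (|ζ| ^ p + |η| ^ q) ^ (1 - 2 / p)
        ≤ (|ζ| ^ p + |η| ^ q) ^ (2 / p) * (|ζ| ^ p + |η| ^ q) ^ (1 - 2 / p) := by gcongr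
      _ = |ζ| ^ p + |η| ^ q := by
          rw [← rpow_add_of_nonneg hG (by positivity) hθ0]; simp

lemma bellman_midpoint {p q : ℝ} (hp : 2 ≤ p) (hq : 1 < q) (hpq : 1 / p + 1 / q = 1)
    (ζ η x y : ℝ) :
    2 * bellman p q ζ η + 2 * |x * y| ≤ bellman p q (ζ + x) (η + y) + bellman p q (ζ - x) (η - y)
    := by
  have hq0 : 0 < q := by linarith
  have hp0 : 0 < p := by linarith
  have hq1 : 0 < q - 1 := by linarith
  have hθ0 : 0 ≤ 1 - 2 / p := by
    rw [sub_nonneg, div_le_one hp0]; exact hp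
  set A := (q ^ 2 + 41) / (q * (q - 1)) with hA
  have hA' : A * (q * (q - 1)) = q ^ 2 + 41 := by rw [hA]; field_simp
  have hcont : ∀ ζ η, Continuous fun ε => bellmanReg p q A ε ζ η := by
    intro ζ η
    unfold bellmanReg
    have h1 : Continuous fun ε : ℝ => (ζ ^ 2 + ε) ^ (p / 2) :=
      (by fun_prop : Continuous fun ε : ℝ => ζ ^ 2 + ε).rpow_const
        fun _ => Or.inr (by positivity)
    have h2 : Continuous fun ε : ℝ => (η ^ 2 + ε) ^ (q / 2) :=
      (by fun_prop : Continuous fun ε : ℝ => η ^ 2 + ε).rpow_const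
        fun _ => Or.inr (by positivity)
    exact (continuous_const.mul h2).add ((by fun_prop : Continuous fun ε : ℝ => ζ ^ 2 + ε).mul
      ((h1.add h2).rpow_const fun _ => Or.inr hθ0))
  have hmem : (0 : ℝ) ∈ closure (Set.Ioi (0 : ℝ)) := by simp
  have := closure_minimal (s := Set.Ioi (0 : ℝ)) (t := {ε | 2 * bellmanReg p q A ε ζ η + 2 * |x * y|
      ≤ bellmanReg p q A ε (ζ + x) (η + y) + bellmanReg p q A ε (ζ - x) (η - y)})
    (fun ε hε => bellmanReg_midpoint hp hq hpq hA' hε ζ η x y)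
    (isClosed_le (((hcont ζ η).const_mul 2).add continuous_const)
      ((hcont _ _).add (hcont _ _))) hmem
  exact this

lemma continuous_bellman {p q : ℝ} (hp : 2 ≤ p) (hq : 1 < q) :
    Continuous fun z : ℝ × ℝ => bellman p q z.1 z.2 := by
  have hp0 : 0 < p := by linarith
  have hθ0 : 0 ≤ 1 - 2 / p := by
    rw [sub_nonneg, div_le_one hp0]; exact hp
  simp only [bellman_eq]
  have h1 : Continuous fun z : ℝ × ℝ => |z.1| ^ p :=
    continuous_fst.abs.rpow_const fun _ => Or.inr (by linarith)
  have h2 : Continuous fun z : ℝ × ℝ => |z.2| ^ q :=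
    continuous_snd.abs.rpow_const fun _ => Or.inr (by linarith)
  exact (continuous_const.mul h2).add ((continuous_fst.abs.pow 2).mul
    ((h1.add h2).rpow_const fun _ => Or.inr hθ0))

lemma exists_bellman {p q : ℝ} (hpq : p.HolderConjugate q) :
    ∃ (Φ : ℝ × ℝ → ℝ) (K : ℝ), 0 < K ∧ Continuous Φ ∧ (∀ z, 0 ≤ Φ z) ∧
      (∀ z, Φ z ≤ K * (|z.1| ^ p + |z.2| ^ q)) ∧
      ∀ z w, 2 * Φ z + 2 * |w.1 * w.2| ≤ Φ (z + w) + Φ (z - w) := by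
  have key : ∀ {p q : ℝ}, 2 ≤ p → 1 < q → 1 / p + 1 / q = 1 →
      ∃ (Φ : ℝ × ℝ → ℝ) (K : ℝ), 0 < K ∧ Continuous Φ ∧ (∀ z, 0 ≤ Φ z) ∧
      (∀ z, Φ z ≤ K * (|z.1| ^ p + |z.2| ^ q)) ∧
      ∀ z w, 2 * Φ z + 2 * |w.1 * w.2| ≤ Φ (z + w) + Φ (z - w) := by
    intro p q hp hq h
    have hq1 : 0 < q - 1 := by linarith
    exact ⟨fun z => bellman p q z.1 z.2, (q ^ 2 + 41) / (q * (q - 1)) + 1, by positivity,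
      continuous_bellman hp hq, fun z => bellman_nonneg hq _ _, fun z => bellman_le hp hq _ _,
      fun z w => bellman_midpoint hp hq h z.1 z.2 w.1 w.2⟩
  have h1 : 1 / p + 1 / q = 1 := by simpa using hpq.inv_add_inv_eq_one
  rcases le_total 2 p with hp | hp
  · exact key hp hpq.symm.lt h1
  · have hq : 2 ≤ q := by
      have h2 : 1 / 2 ≤ 1 / p := one_div_le_one_div_of_le hpq.pos hp
      have h3 : 1 / q ≤ 1 / 2 := by linarith
      exact (one_div_le_one_div hpq.symm.pos two_pos).1 h3
    obtain ⟨Φ, K, hK, hc, h0, hle, hm⟩ := key hq hpq.lt (by linarith)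
    refine ⟨fun z => Φ z.swap, K, hK, hc.comp continuous_swap, fun z => h0 _, fun z => ?_,
      fun z w => ?_⟩
    · simpa [add_comm] using hle z.swap
    · simpa [mul_comm] using hm z.swap w.swap

lemma convexOn_univ_of_midpoint {V : Type*} [NormedAddCommGroup V] [NormedSpace ℝ V] {Φ : V → ℝ}
    (hc : Continuous Φ) (hm : ∀ z w, 2 * Φ z ≤ Φ (z + w) + Φ (z - w)) :
    ConvexOn ℝ Set.univ Φ := by
  refine ⟨convex_univ, fun x _ y _ a b ha hb hab => ?_⟩
  let g : ℝ → ℝ := fun t => Φ (x + t • (y - x)) - Φ x - t * (Φ y - Φ x)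
  have hg : Continuous g := by
    have : Continuous fun t : ℝ => Φ (x + t • (y - x)) := hc.comp (by fun_prop)
    fun_prop
  have hgm : ∀ s d, 2 * g s ≤ g (s + d) + g (s - d) := by
    intro s d
    have := hm (x + s • (y - x)) (d • (y - x))
    have e1 : x + s • (y - x) + d • (y - x) = x + (s + d) • (y - x) := by module
    have e2 : x + s • (y - x) - d • (y - x) = x + (s - d) • (y - x) := by module
    rw [e1, e2] at this
    simp only [g]
    linarith
  have hg0 : g 0 = 0 := by simp [g]
  have hg1 : g 1 = 0 := by simp [g]
  have hgle : ∀ t ∈ Set.Icc (0 : ℝ) 1, g t ≤ 0 := by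
    obtain ⟨t₀, ht₀, hmax⟩ := isCompact_Icc.exists_isMaxOn (Set.nonempty_Icc.2 zero_le_one)
      hg.continuousOn (s := Set.Icc (0 : ℝ) 1)
    by_contra! hcon
    obtain ⟨t₁, ht₁, hpos⟩ := hcon
    have hpos0 : 0 < g t₀ := hpos.trans_le (hmax ht₁)
    have hS : IsCompact (Set.Icc (0 : ℝ) 1 ∩ g ⁻¹' {g t₀}) :=
      isCompact_Icc.inter_right (isClosed_singleton.preimage hg)
    obtain ⟨s, ⟨hs, hsg⟩, hleast⟩ := hS.exists_isLeast ⟨t₀, ht₀, rfl⟩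
    have hsg' : g s = g t₀ := hsg
    have hs0 : 0 < s := lt_of_le_of_ne hs.1 (by rintro rfl; linarith)
    have hs1 : s < 1 := lt_of_le_of_ne hs.2 (by rintro rfl; linarith)
    set d := min s (1 - s) with hd
    have hd0 : 0 < d := lt_min hs0 (by linarith)
    have hds : d ≤ s := min_le_left _ _
    have hds1 : d ≤ 1 - s := min_le_right _ _
    have m1 : s + d ∈ Set.Icc (0 : ℝ) 1 := ⟨by linarith, by linarith⟩
    have m2 : s - d ∈ Set.Icc (0 : ℝ) 1 := ⟨by linarith, by linarith⟩
    have l1 : g (s + d) ≤ g t₀ := hmax m1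
    have l2 : g (s - d) < g t₀ := by
      refine lt_of_le_of_ne (hmax m2) fun h => ?_
      have := hleast ⟨m2, h⟩
      linarith
    linarith [hgm s d]
  have hb1 : b ≤ 1 := by linarith
  have h := hgle b ⟨hb, hb1⟩
  have e : x + b • (y - x) = a • x + b • y := by
    rw [← eq_sub_iff_add_eq] at hab; subst hab; module
  simp only [g, e] at h
  have : a = 1 - b := by linarith
  simp only [smul_eq_mul]
  rw [this]
  rw [this] at h
  linarith

section Discrete

variable {E ι : Type*} [AddCommGroup E] [Fintype ι]

/-- The average of the two translates of `f` by `w` and `-w`. -/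
noncomputable def symAvg (w : E) (f : E → ℝ) (x : E) : ℝ := (f (x + w) + f (x - w)) / 2

/-- The symmetric difference of `f` with step `w`. -/
noncomputable def symDif (w : E) (f : E → ℝ) (x : E) : ℝ := (f (x + w) - f (x - w)) / 2

/-- The average of the translates of `f` by the vectors `v i` and `-v i`. -/
noncomputable def latAvg (v : ι → E) (f : E → ℝ) (x : E) : ℝ :=
  ∑ i, (Fintype.card ι : ℝ)⁻¹ * symAvg (v i) f x

lemma symDif_latAvg (w : E) (v : ι → E) (f : E → ℝ) :
    symDif w (latAvg v f) = latAvg v (symDif w f) := by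
  funext x
  simp only [symDif, latAvg, symAvg]
  rw [← Finset.sum_sub_distrib, Finset.sum_div]
  refine Finset.sum_congr rfl fun i _ => ?_
  rw [add_right_comm x w, add_sub_right_comm x w, sub_add_eq_add_sub x w, sub_right_comm x w]
  ring

lemma latAvg_sub (v : ι → E) (f g : E → ℝ) :
    latAvg v (f - g) = latAvg v f - latAvg v g := by
  funext x
  simp only [latAvg, symAvg, Pi.sub_apply]
  rw [← Finset.sum_sub_distrib]
  exact Finset.sum_congr rfl fun i _ => by ring

lemma latAvg_const_mul (v : ι → E) (c : ℝ) (f : E → ℝ) :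
    latAvg v (fun x => c * f x) = fun x => c * latAvg v f x := by
  funext x
  simp only [latAvg, symAvg, Finset.mul_sum]
  exact Finset.sum_congr rfl fun i _ => by ring

lemma symDif_sub (w : E) (f g : E → ℝ) : symDif w (f - g) = symDif w f - symDif w g := by
  funext x
  simp only [symDif, Pi.sub_apply]
  ring

lemma symDif_const_mul (w : E) (c : ℝ) (f : E → ℝ) :
    symDif w (fun x => c * f x) = fun x => c * symDif w f x := by
  funext x
  simp only [symDif]
  ring

lemma latAvg_iterate_sub (v : ι → E) (n : ℕ) (f g : E → ℝ) :
    (latAvg v)^[n] (f - g) = (latAvg v)^[n] f - (latAvg v)^[n] g := by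
  induction n generalizing f g with
  | zero => rfl
  | succ n ih => simp only [Function.iterate_succ, Function.comp, latAvg_sub, ih]

variable [MeasurableSpace E] [MeasurableAdd E] {μ : Measure E} [μ.IsAddRightInvariant]
  {p q : ENNReal} {f g : E → ℝ}

lemma MeasureTheory.MemLp.add_right (hf : MemLp f p μ) (w : E) :
    MemLp (fun x => f (x + w)) p μ :=
  hf.comp_measurePreserving (measurePreserving_add_right μ w)

lemma MeasureTheory.MemLp.sub_right (hf : MemLp f p μ) (w : E) :
    MemLp (fun x => f (x - w)) p μ := by
  simpa only [sub_eq_add_neg] using hf.add_right (-w)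

lemma MeasureTheory.MemLp.symAvg (hf : MemLp f p μ) (w : E) : MemLp (symAvg w f) p μ := by
  have := ((hf.add_right w).add (hf.sub_right w)).const_mul (1 / 2)
  exact (memLp_congr_ae (.of_forall fun x => by simp [_root_.symAvg]; ring)).1 this

lemma MeasureTheory.MemLp.symDif (hf : MemLp f p μ) (w : E) : MemLp (symDif w f) p μ := by
  have := ((hf.add_right w).sub (hf.sub_right w)).const_mul (1 / 2)
  exact (memLp_congr_ae (.of_forall fun x => by simp [_root_.symDif]; ring)).1 this

lemma MeasureTheory.MemLp.latAvg (hf : MemLp f p μ) (v : ι → E) : MemLp (latAvg v f) p μ :=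
  memLp_finsetSum _ fun i _ => (hf.symAvg (v i)).const_mul _

lemma MeasureTheory.MemLp.latAvg_iterate (hf : MemLp f p μ) (v : ι → E) (n : ℕ) :
    MemLp ((_root_.latAvg v)^[n] f) p μ := by
  induction n generalizing f with
  | zero => exact hf
  | succ n ih => exact ih (hf.latAvg v)

end Discrete

lemma integrable_abs_rpow_of_memLp {α : Type*} [MeasurableSpace α] {μ : Measure α} {f : α → ℝ}
    {p : ℝ} (hp : 0 < p) (hf : MemLp f (.ofReal p) μ) :
    Integrable (fun x => |f x| ^ p) μ := by
  simpa [ENNReal.toReal_ofReal hp.le] using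
    hf.integrable_norm_rpow (by simpa using hp) (by simp)

lemma integrable_mul_of_memLp {α : Type*} [MeasurableSpace α] {μ : Measure α} {f g : α → ℝ}
    {p q : ℝ} (hpq : p.HolderConjugate q) (hf : MemLp f (.ofReal p) μ)
    (hg : MemLp g (.ofReal q) μ) : Integrable (fun x => f x * g x) μ := by
  have := hpq.ennrealOfReal
  exact hf.integrable_mul hg

section Discrete

variable {E ι : Type*} [AddCommGroup E] [Fintype ι] [MeasurableSpace E] [MeasurableAdd E]
  {μ : Measure E} [μ.IsAddRightInvariant] {p q : ℝ} {f g u v : E → ℝ}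

lemma integral_comp_add_right_sub (h : E → ℝ) (w : E) :
    ∫ x, h (x - w) ∂μ = ∫ x, h x ∂μ := by
  simpa only [sub_eq_add_neg] using integral_add_right_eq_self h (-w)

lemma integral_symAvg_mul (hpq : p.HolderConjugate q) (hf : MemLp f (.ofReal p) μ)
    (hg : MemLp g (.ofReal q) μ) (w : E) :
    ∫ x, symAvg w f x * g x ∂μ = ∫ x, f x * symAvg w g x ∂μ := by
  have e1 : ∫ x, f (x + w) * g x ∂μ = ∫ x, f x * g (x - w) ∂μ := by
    simpa using integral_add_right_eq_self (μ := μ) (fun x => f x * g (x - w)) w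
  have e2 : ∫ x, f (x - w) * g x ∂μ = ∫ x, f x * g (x + w) ∂μ := by
    simpa using integral_comp_add_right_sub (μ := μ) (fun x => f x * g (x + w)) w
  have i1 := integrable_mul_of_memLp hpq (hf.add_right w) hg
  have i2 := integrable_mul_of_memLp hpq (hf.sub_right w) hg
  have i3 := integrable_mul_of_memLp hpq hf (hg.add_right w)
  have i4 := integrable_mul_of_memLp hpq hf (hg.sub_right w)
  simp only [symAvg, div_mul_eq_mul_div, mul_div_assoc', integral_div, add_mul, mul_add]
  rw [integral_add i1 i2, integral_add i3 i4, e1, e2, add_comm]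

lemma integral_symDif_mul (hpq : p.HolderConjugate q) (hf : MemLp f (.ofReal p) μ)
    (hg : MemLp g (.ofReal q) μ) (w : E) :
    ∫ x, symDif w f x * g x ∂μ = -∫ x, f x * symDif w g x ∂μ := by
  have e1 : ∫ x, f (x + w) * g x ∂μ = ∫ x, f x * g (x - w) ∂μ := by
    simpa using integral_add_right_eq_self (μ := μ) (fun x => f x * g (x - w)) w
  have e2 : ∫ x, f (x - w) * g x ∂μ = ∫ x, f x * g (x + w) ∂μ := by
    simpa using integral_comp_add_right_sub (μ := μ) (fun x => f x * g (x + w)) w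
  have i1 := integrable_mul_of_memLp hpq (hf.add_right w) hg
  have i2 := integrable_mul_of_memLp hpq (hf.sub_right w) hg
  have i3 := integrable_mul_of_memLp hpq hf (hg.add_right w)
  have i4 := integrable_mul_of_memLp hpq hf (hg.sub_right w)
  simp only [symDif, div_mul_eq_mul_div, mul_div_assoc', integral_div, sub_mul, mul_sub]
  rw [integral_sub i1 i2, integral_sub i3 i4, e1, e2]
  ring

lemma integral_latAvg_mul (hpq : p.HolderConjugate q) (hf : MemLp f (.ofReal p) μ)
    (hg : MemLp g (.ofReal q) μ) (a : ι → E) :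
    ∫ x, latAvg a f x * g x ∂μ = ∫ x, f x * latAvg a g x ∂μ := by
  simp only [latAvg, Finset.sum_mul, Finset.mul_sum, mul_assoc]
  simp only [mul_left_comm (f _)]
  rw [integral_finsetSum _ fun i _ => ?_, integral_finsetSum _ fun i _ => ?_]
  · refine Finset.sum_congr rfl fun i _ => ?_
    rw [integral_const_mul, integral_const_mul, integral_symAvg_mul hpq hf hg]
  · exact (integrable_mul_of_memLp hpq hf (hg.symAvg (a i))).const_mul _
  · exact (integrable_mul_of_memLp hpq (hf.symAvg (a i)) hg).const_mul _

lemma integral_latAvg {h : E → ℝ} [Nonempty ι] (hh : Integrable h μ) (a : ι → E) :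
    ∫ x, latAvg a h x ∂μ = ∫ x, h x ∂μ := by
  have h1 : ∀ i, Integrable (fun x => h (x + a i)) μ := fun i => hh.comp_add_right (a i)
  have h2 : ∀ i, Integrable (fun x => h (x - a i)) μ := fun i => hh.comp_sub_right (a i)
  have h3 : ∀ i, Integrable (fun x => (Fintype.card ι : ℝ)⁻¹ *
      ((h (x + a i) + h (x - a i)) / 2)) μ := fun i =>
    (((h1 i).add (h2 i)).div_const 2).const_mul _
  simp only [latAvg, symAvg]
  rw [integral_finsetSum _ fun i _ => h3 i]
  have : ∀ i, ∫ x, (Fintype.card ι : ℝ)⁻¹ * ((h (x + a i) + h (x - a i)) / 2) ∂μ =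
      (Fintype.card ι : ℝ)⁻¹ * ∫ x, h x ∂μ := fun i => by
    rw [integral_const_mul, integral_div, integral_add (h1 i) (h2 i),
      integral_add_right_eq_self, integral_comp_add_right_sub]
    ring
  simp [this]

lemma integrable_latAvg {h : E → ℝ} (hh : Integrable h μ) (a : ι → E) :
    Integrable (latAvg a h) μ :=
  integrable_finsetSum _ fun i _ =>
    (((hh.comp_add_right (a i)).add (hh.comp_sub_right (a i))).div_const 2).const_mul _

lemma integral_bellman_latAvg_le [Nonempty ι] {Φ : ℝ × ℝ → ℝ} {K : ℝ}
    (hp : 0 < p) (hq : 0 < q) (hc : Continuous Φ) (h0 : ∀ z, 0 ≤ Φ z)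
    (hle : ∀ z, Φ z ≤ K * (|z.1| ^ p + |z.2| ^ q))
    (hm : ∀ z w, 2 * Φ z + 2 * |w.1 * w.2| ≤ Φ (z + w) + Φ (z - w))
    (hpq : p.HolderConjugate q) (hu : MemLp u (.ofReal p) μ) (hv : MemLp v (.ofReal q) μ)
    (a : ι → E) (i : ι) :
    ∫ x, |symDif (a i) u x * symDif (a i) v x| ∂μ +
      Fintype.card ι * ∫ x, Φ (latAvg a u x, latAvg a v x) ∂μ ≤
      Fintype.card ι * ∫ x, Φ (u x, v x) ∂μ := by
  have hInt : ∀ {u v : E → ℝ}, MemLp u (.ofReal p) μ → MemLp v (.ofReal q) μ →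
      Integrable (fun x => Φ (u x, v x)) μ := fun {u v} hu hv => by
    refine (((integrable_abs_rpow_of_memLp hp hu).add
      (integrable_abs_rpow_of_memLp hq hv)).const_mul K).mono'
      (hc.comp_aestronglyMeasurable (hu.1.prodMk hv.1)) (.of_forall fun x => ?_)
    rw [Real.norm_of_nonneg (h0 _)]
    exact hle _
  have hcard : (0 : ℝ) < Fintype.card ι := by exact_mod_cast Fintype.card_pos
  have hconv := convexOn_univ_of_midpoint hc fun z w => by
    linarith [hm z w, abs_nonneg (w.1 * w.2)]
  have hD := (integrable_mul_of_memLp hpq (hu.symDif (a i)) (hv.symDif (a i))).abs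
  have hΦ := hInt hu hv
  have hpt : ∀ x, (Fintype.card ι : ℝ)⁻¹ * |symDif (a i) u x * symDif (a i) v x| +
      Φ (latAvg a u x, latAvg a v x) ≤ latAvg a (fun x => Φ (u x, v x)) x := by
    intro x
    have h1 : Φ (latAvg a u x, latAvg a v x) ≤
        ∑ j, (Fintype.card ι : ℝ)⁻¹ * Φ (symAvg (a j) u x, symAvg (a j) v x) := by
      have := hconv.map_sum_le (t := Finset.univ) (w := fun _ : ι => (Fintype.card ι : ℝ)⁻¹)
        (p := fun j => (symAvg (a j) u x, symAvg (a j) v x)) (fun _ _ => by positivity)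
        (by simp) (fun _ _ => trivial)
      simp only [smul_eq_mul] at this
      have e : (latAvg a u x, latAvg a v x) =
          ∑ j, (Fintype.card ι : ℝ)⁻¹ • (symAvg (a j) u x, symAvg (a j) v x) := by
        simp [Prod.ext_iff, latAvg, Prod.fst_sum, Prod.snd_sum]
      rw [e]
      exact this
    have h2 : ∀ j, Φ (symAvg (a j) u x, symAvg (a j) v x) +
        |symDif (a j) u x * symDif (a j) v x| ≤ symAvg (a j) (fun x => Φ (u x, v x)) x := by
      intro j
      have := hm (symAvg (a j) u x, symAvg (a j) v x) (symDif (a j) u x, symDif (a j) v x)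
      have e1 : (symAvg (a j) u x, symAvg (a j) v x) + (symDif (a j) u x, symDif (a j) v x) =
          (u (x + a j), v (x + a j)) := by
        ext <;> simp [symAvg, symDif] <;> ring
      have e2 : (symAvg (a j) u x, symAvg (a j) v x) - (symDif (a j) u x, symDif (a j) v x) =
          (u (x - a j), v (x - a j)) := by
        ext <;> simp [symAvg, symDif] <;> ring
      rw [e1, e2] at this
      simp only [symAvg] at this ⊢
      linarith
    have h3 : (Fintype.card ι : ℝ)⁻¹ * |symDif (a i) u x * symDif (a i) v x| ≤
        ∑ j, (Fintype.card ι : ℝ)⁻¹ * |symDif (a j) u x * symDif (a j) v x| :=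
      Finset.single_le_sum (f := fun j => (Fintype.card ι : ℝ)⁻¹ *
        |symDif (a j) u x * symDif (a j) v x|) (fun j _ => by positivity) (Finset.mem_univ i)
    have h4 : ∑ j, (Fintype.card ι : ℝ)⁻¹ * |symDif (a j) u x * symDif (a j) v x| +
        ∑ j, (Fintype.card ι : ℝ)⁻¹ * Φ (symAvg (a j) u x, symAvg (a j) v x) ≤
        latAvg a (fun x => Φ (u x, v x)) x := by
      rw [← Finset.sum_add_distrib]
      refine Finset.sum_le_sum fun j _ => ?_
      rw [← mul_add]
      gcongr
      linarith [h2 j]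
    linarith
  have := integral_mono ((hD.const_mul (Fintype.card ι : ℝ)⁻¹).add
    (hInt (hu.latAvg a) (hv.latAvg a))) (integrable_latAvg hΦ a) hpt
  rw [integral_latAvg hΦ, integral_add' (hD.const_mul _) (hInt (hu.latAvg a) (hv.latAvg a)),
    integral_const_mul] at this
  have h5 := mul_le_mul_of_nonneg_left this hcard.le
  rw [mul_add, mul_inv_cancel_left₀ hcard.ne'] at h5
  exact h5

lemma sum_integral_symDif_le [Nonempty ι] (hpq : p.HolderConjugate q) :
    ∃ K : ℝ, 0 < K ∧ ∀ (u v : E → ℝ), MemLp u (.ofReal p) μ → MemLp v (.ofReal q) μ →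
      ∀ (a : ι → E) (i : ι) (M : ℕ),
      ∑ n ∈ Finset.range M, ∫ x, |symDif (a i) ((latAvg a)^[n] u) x *
        symDif (a i) ((latAvg a)^[n] v) x| ∂μ ≤
      K * (∫ x, |u x| ^ p ∂μ + ∫ x, |v x| ^ q ∂μ) := by
  obtain ⟨Φ, K, hK, hc, h0, hle, hm⟩ := exists_bellman hpq
  have hcard : (0 : ℝ) < Fintype.card ι := by exact_mod_cast Fintype.card_pos
  refine ⟨Fintype.card ι * K, by positivity, fun u v hu hv a i M => ?_⟩
  have key : ∀ M, ∑ n ∈ Finset.range M, ∫ x, |symDif (a i) ((latAvg a)^[n] u) x *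
        symDif (a i) ((latAvg a)^[n] v) x| ∂μ +
        Fintype.card ι * ∫ x, Φ ((latAvg a)^[M] u x, (latAvg a)^[M] v x) ∂μ ≤
        Fintype.card ι * ∫ x, Φ (u x, v x) ∂μ := by
    intro M
    induction M with
    | zero => simp
    | succ M ih =>
      rw [Finset.sum_range_succ]
      have := integral_bellman_latAvg_le hpq.pos hpq.symm.pos hc h0 hle hm hpq
        (hu.latAvg_iterate a M) (hv.latAvg_iterate a M) a i
      simp only [Function.iterate_succ_apply']
      linarith
  have h1 : 0 ≤ ∫ x, Φ ((latAvg a)^[M] u x, (latAvg a)^[M] v x) ∂μ :=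
    integral_nonneg fun x => h0 _
  have h2 : ∫ x, Φ (u x, v x) ∂μ ≤ K * (∫ x, |u x| ^ p ∂μ + ∫ x, |v x| ^ q ∂μ) := by
    have i1 := integrable_abs_rpow_of_memLp hpq.pos hu
    have i2 := integrable_abs_rpow_of_memLp hpq.symm.pos hv
    rw [← integral_add i1 i2, ← integral_const_mul]
    exact integral_mono_of_nonneg (.of_forall fun x => h0 _) ((i1.add i2).const_mul K)
      (.of_forall fun x => hle _)
  have h3 := mul_le_mul_of_nonneg_left h2 hcard.le
  have h4 := key M
  have : 0 ≤ Fintype.card ι * ∫ x, Φ ((latAvg a)^[M] u x, (latAvg a)^[M] v x) ∂μ := by positivity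
  linarith

end Discrete

section Discrete

variable {E ι : Type*} [AddCommGroup E] [Fintype ι] [MeasurableSpace E] [MeasurableAdd E]
  {μ : Measure E} [μ.IsAddRightInvariant] {p q : ℝ}

lemma abs_integral_symDif_symDif_mul_le (μ : Measure E) [μ.IsAddRightInvariant] [Nonempty ι]
    (hpq : p.HolderConjugate q) :
    ∃ K : ℝ, 0 < K ∧ ∀ (u v : E → ℝ), MemLp u (.ofReal p) μ → MemLp v (.ofReal q) μ →
      ∀ (a : ι → E) (i : ι), |∫ x, symDif (a i) (symDif (a i) u) x * v x ∂μ| ≤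
      K * (∫ x, |u x - latAvg a (latAvg a u) x| ^ p ∂μ + ∫ x, |v x| ^ q ∂μ) := by
  obtain ⟨K, hK, hsum⟩ := sum_integral_symDif_le (μ := μ) (ι := ι) hpq
  refine ⟨K, hK, fun u v hu hv a i => ?_⟩
  rw [integral_symDif_mul hpq (hu.symDif _) hv, abs_neg]
  let c : ℕ → ℝ := fun n => ∫ x, symDif (a i) ((latAvg a)^[n] u) x *
    symDif (a i) ((latAvg a)^[n] v) x ∂μ
  have hc0 : Filter.Tendsto c Filter.atTop (nhds 0) := by
    have hs : Summable fun n => ∫ x, |symDif (a i) ((latAvg a)^[n] u) x *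
        symDif (a i) ((latAvg a)^[n] v) x| ∂μ :=
      summable_of_sum_range_le (fun n => integral_nonneg fun x => abs_nonneg _)
        (hsum u v hu hv a i)
    exact squeeze_zero_norm (fun n => norm_integral_le_integral_norm _) hs.tendsto_atTop_zero
  set w : E → ℝ := u - latAvg a (latAvg a u) with hw
  have hwm : MemLp w (.ofReal p) μ := hu.sub ((hu.latAvg a).latAvg a)
  have hstep : ∀ n, c n - c (n + 1) = ∫ x, symDif (a i) ((latAvg a)^[n] w) x *
      symDif (a i) ((latAvg a)^[n] v) x ∂μ := by
    intro n
    have hP := (hu.latAvg_iterate a n).symDif (a i)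
    have hQ := (hv.latAvg_iterate a n).symDif (a i)
    have e : symDif (a i) ((latAvg a)^[n] w) = symDif (a i) ((latAvg a)^[n] u) -
        latAvg a (latAvg a (symDif (a i) ((latAvg a)^[n] u))) := by
      have hcomm : ∀ y, (latAvg a)^[n] (latAvg a y) = latAvg a ((latAvg a)^[n] y) := fun y => by
        rw [← Function.iterate_succ_apply, Function.iterate_succ_apply']
      rw [hw, latAvg_iterate_sub, symDif_sub, hcomm, hcomm, symDif_latAvg, symDif_latAvg]
    have e1 : c (n + 1) = ∫ x, latAvg a (latAvg a (symDif (a i) ((latAvg a)^[n] u))) x *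
        symDif (a i) ((latAvg a)^[n] v) x ∂μ := by
      rw [integral_latAvg_mul hpq (hP.latAvg a) hQ]
      simp only [c, Function.iterate_succ_apply', symDif_latAvg]
    rw [e, e1]
    simp only [Pi.sub_apply, sub_mul]
    rw [integral_sub (integrable_mul_of_memLp hpq hP hQ)
      (integrable_mul_of_memLp hpq ((hP.latAvg a).latAvg a) hQ)]
  have hle : ∀ M, |c 0 - c M| ≤ K * (∫ x, |w x| ^ p ∂μ + ∫ x, |v x| ^ q ∂μ) := by
    intro M
    refine le_trans ?_ (hsum w v hwm hv a i M)
    rw [← Finset.sum_range_sub' c M]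
    refine (Finset.abs_sum_le_sum_abs _ _).trans (Finset.sum_le_sum fun n _ => ?_)
    rw [hstep]
    exact abs_integral_le_integral_abs
  have hlim : Filter.Tendsto (fun M => |c 0 - c M|) Filter.atTop (nhds |c 0 - 0|) :=
    (tendsto_const_nhds.sub hc0).abs
  rw [sub_zero] at hlim
  exact le_of_tendsto' hlim hle

lemma integral_abs_sub_latAvg_latAvg_le [Nonempty ι] (hp : 1 ≤ p) {u : E → ℝ}
    (hu : MemLp u (.ofReal p) μ) (a : ι → E) :
    ∫ x, |u x - latAvg a (latAvg a u) x| ^ p ∂μ ≤ 2 ^ p * ∫ x, |u x - latAvg a u x| ^ p ∂μ := by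
  have hp0 : 0 < p := by linarith
  set w := u - latAvg a u with hw
  have hwm : MemLp w (.ofReal p) μ := hu.sub (hu.latAvg a)
  have hwi := integrable_abs_rpow_of_memLp hp0 hwm
  have hwi' := integrable_abs_rpow_of_memLp hp0 (hwm.latAvg a)
  have e : ∀ x, u x - latAvg a (latAvg a u) x = w x + latAvg a w x := by
    intro x
    rw [hw, latAvg_sub]
    simp
  have hconv := convexOn_rpow hp
  have hcard : (0 : ℝ) < Fintype.card ι := by exact_mod_cast Fintype.card_pos
  have hmid : ∀ s t : ℝ, |(s + t) / 2| ^ p ≤ (|s| ^ p + |t| ^ p) / 2 := by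
    intro s t
    have h1 := hconv.2 (x := |s|) (y := |t|) (abs_nonneg s) (abs_nonneg t)
      (show (0 : ℝ) ≤ 1 / 2 by norm_num) (show (0 : ℝ) ≤ 1 / 2 by norm_num) (by norm_num)
    have h2 : |(s + t) / 2| ≤ (1 / 2 : ℝ) • |s| + (1 / 2 : ℝ) • |t| := by
      rw [abs_div, abs_two, smul_eq_mul, smul_eq_mul]
      linarith [abs_add_le s t]
    calc |(s + t) / 2| ^ p ≤ ((1 / 2 : ℝ) • |s| + (1 / 2 : ℝ) • |t|) ^ p := by gcongr
      _ ≤ _ := h1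
      _ = _ := by simp only [smul_eq_mul]; ring
  have havg : ∀ x, |latAvg a w x| ^ p ≤ latAvg a (fun x => |w x| ^ p) x := by
    intro x
    have h1 := hconv.map_sum_le (t := Finset.univ) (w := fun _ : ι => (Fintype.card ι : ℝ)⁻¹)
      (p := fun j => |symAvg (a j) w x|) (fun _ _ => by positivity) (by simp)
      (fun j _ => abs_nonneg (symAvg (a j) w x))
    simp only [smul_eq_mul] at h1
    calc |latAvg a w x| ^ p ≤ (∑ j, (Fintype.card ι : ℝ)⁻¹ * |symAvg (a j) w x|) ^ p := by
          gcongr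
          refine (Finset.abs_sum_le_sum_abs _ _).trans (Finset.sum_le_sum fun j _ => ?_)
          rw [abs_mul, abs_of_pos (inv_pos.2 hcard)]
      _ ≤ _ := h1
      _ ≤ _ := Finset.sum_le_sum fun j _ => by
          gcongr
          exact hmid _ _
  have hpt : ∀ x, |u x - latAvg a (latAvg a u) x| ^ p ≤
      2 ^ p * ((|w x| ^ p + |latAvg a w x| ^ p) / 2) := by
    intro x
    rw [e]
    calc |w x + latAvg a w x| ^ p = 2 ^ p * |(w x + latAvg a w x) / 2| ^ p := by
          rw [← mul_rpow two_pos.le (abs_nonneg _), abs_div, abs_two]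
          congr 1; ring
      _ ≤ _ := by
          gcongr
          exact hmid _ _
  have h1 := integral_mono_of_nonneg (.of_forall fun x => by positivity)
    (((hwi.add hwi').div_const 2).const_mul (2 ^ p)) (.of_forall hpt)
  have h2 : ∫ x, |latAvg a w x| ^ p ∂μ ≤ ∫ x, |w x| ^ p ∂μ := by
    rw [← integral_latAvg hwi a]
    exact integral_mono hwi' (integrable_latAvg hwi a) havg
  refine h1.trans ?_
  simp only [Pi.add_apply]
  rw [integral_const_mul, integral_div, integral_add hwi hwi']
  gcongr
  change _ ≤ ∫ x, |w x| ^ p ∂μ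
  linarith

lemma integral_symDif_symDif_rpow_le (μ : Measure E) [μ.IsAddRightInvariant] [Nonempty ι]
    (hp : 1 < p) :
    ∃ K : ℝ, 0 < K ∧ ∀ (u : E → ℝ), MemLp u (.ofReal p) μ → ∀ (a : ι → E) (i : ι),
      ∫ x, |symDif (a i) (symDif (a i) u) x| ^ p ∂μ ≤
        K * ∫ x, |u x - latAvg a u x| ^ p ∂μ := by
  have hpq : p.HolderConjugate p.conjExponent := .conjExponent hp
  set q := p.conjExponent
  have hp0 := hpq.pos
  have hq0 := hpq.symm.pos
  obtain ⟨K, hK, hle⟩ := abs_integral_symDif_symDif_mul_le (ι := ι) μ hpq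
  set s : ℝ := (2 * K) ^ (1 / q) with hs
  have hs0 : 0 < s := by positivity
  have hsq : s ^ q = 2 * K := by
    rw [hs, ← rpow_mul (by positivity), one_div_mul_cancel hq0.ne', rpow_one]
  refine ⟨2 * K * s ^ p * 2 ^ p, by positivity, fun u hu a i => ?_⟩
  set F := symDif (a i) (symDif (a i) u) with hF
  have hFm : MemLp F (.ofReal p) μ := (hu.symDif _).symDif _
  set g : E → ℝ := fun x => SignType.sign (F x) * |F x| ^ (p - 1) with hg
  have habs : ∀ x, |g x| ^ q = |F x| ^ p := by
    intro x
    have h1 : |g x| = |F x| ^ (p - 1) := by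
      rcases eq_or_ne (F x) 0 with h | h
      · simp [hg, h, zero_rpow (by linarith : p - 1 ≠ 0)]
      · simp only [hg, abs_mul]
        rw [abs_of_nonneg (by positivity : 0 ≤ |F x| ^ (p - 1))]
        rcases h.lt_or_gt with h | h
        · simp [sign_neg h]
        · simp [sign_pos h]
    rw [h1, ← rpow_mul (abs_nonneg _)]
    congr 1
    exact hpq.sub_one_mul_conj
  have hFg : ∀ x, F x * g x = |F x| ^ p := by
    intro x
    rw [hg]
    rcases eq_or_ne (F x) 0 with h | h
    · simp [h, zero_rpow (by linarith : p ≠ 0)]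
    · rw [← mul_assoc, mul_comm (F x), sign_mul_self, ← rpow_one_add' (abs_nonneg _) (by linarith)]
      congr 1; ring
  have hFi := integrable_abs_rpow_of_memLp hp0 hFm
  have hgae : AEStronglyMeasurable g μ := by
    have h1 : Measurable fun t : ℝ => ((SignType.sign t : ℝ)) * |t| ^ (p - 1) := by
      have : Measurable fun t : ℝ => (SignType.sign t : ℝ) := by
        have h2 : Monotone fun t : ℝ => (SignType.sign t : ℝ) := fun x y h => by
          have h3 := SignType.sign.monotone h
          dsimp only
          generalize SignType.sign x = c at h3 ⊢
          generalize SignType.sign y = d at h3 ⊢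
          cases c <;> cases d <;> first | exact absurd h3 (by decide) | norm_num
        exact h2.measurable
      fun_prop
    exact (h1.comp_aemeasurable hFm.1.aemeasurable).aestronglyMeasurable
  have hgm : MemLp g (.ofReal q) μ := by
    rw [← integrable_norm_rpow_iff hgae (by simpa using hq0) (by simp),
      ENNReal.toReal_ofReal hq0.le]
    exact hFi.congr (.of_forall fun x => (habs x).symm)
  have h := hle (fun x => s * u x) (fun x => s⁻¹ * g x) (hu.const_mul s) (hgm.const_mul s⁻¹) a i
  have e1 : ∀ x, symDif (a i) (symDif (a i) fun x => s * u x) x * (s⁻¹ * g x) = |F x| ^ p := by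
    intro x
    rw [symDif_const_mul, symDif_const_mul, ← hFg]
    field_simp
    exact mul_comm _ _
  have e2 : ∀ x, |s * u x - latAvg a (latAvg a fun x => s * u x) x| ^ p =
      s ^ p * |u x - latAvg a (latAvg a u) x| ^ p := by
    intro x
    rw [latAvg_const_mul, latAvg_const_mul, ← mul_sub, abs_mul, abs_of_pos hs0,
      mul_rpow hs0.le (abs_nonneg _)]
  have e3 : ∀ x, |s⁻¹ * g x| ^ q = (2 * K)⁻¹ * |F x| ^ p := by
    intro x
    rw [abs_mul, abs_of_pos (inv_pos.2 hs0), mul_rpow (by positivity) (abs_nonneg _), habs,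
      inv_rpow hs0.le, hsq]
  simp only [e1, e2, e3, integral_const_mul] at h
  have h2 := (le_abs_self _).trans h
  have h3 : K * ((2 * K)⁻¹ * ∫ x, |F x| ^ p ∂μ) = (∫ x, |F x| ^ p ∂μ) / 2 := by field_simp
  rw [mul_add, h3] at h2
  have h4 := integral_abs_sub_latAvg_latAvg_le hp.le hu a
  calc ∫ x, |F x| ^ p ∂μ ≤ 2 * K * s ^ p * ∫ x, |u x - latAvg a (latAvg a u) x| ^ p ∂μ := by
        linarith
    _ ≤ 2 * K * s ^ p * (2 ^ p * ∫ x, |u x - latAvg a u x| ^ p ∂μ) := by gcongr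
    _ = _ := by ring

end Discrete

section Schwartz

open scoped SchwartzMap LineDeriv Laplacian FourierTransform

/-- The second difference quotient of `f` in direction `e` with step `h`. -/
noncomputable def secondDifQuot {E : Type*} [AddCommGroup E] [Module ℝ E] (e : E) (f : E → ℝ)
    (h : ℝ) (x : E) : ℝ :=
  (f (x + h • e) + f (x - h • e) - 2 * f x) / h ^ 2

lemma SchwartzMap.hasDerivAt_line {E F : Type*} [NormedAddCommGroup E] [NormedSpace ℝ E]
    [NormedAddCommGroup F] [NormedSpace ℝ F] (f : 𝓢(E, F)) (x e : E) (t : ℝ) :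
    HasDerivAt (fun t : ℝ => f (x + t • e)) (∂_{e} f (x + t • e)) t := by
  have h1 : HasFDerivAt f (fderiv ℝ f (x + t • e)) (x + t • e) :=
    f.differentiable.differentiableAt.hasFDerivAt
  have h2 : HasDerivAt (fun t : ℝ => x + t • e) e t := by
    simpa using ((hasDerivAt_id t).smul_const e).const_add x
  exact h1.comp_hasDerivAt t h2

lemma exists_secondDifQuot_eq {E : Type*} [NormedAddCommGroup E] [NormedSpace ℝ E]
    (f : 𝓢(E, ℝ)) (e x : E) {h : ℝ} (hh : 0 < h) :
    ∃ c : ℝ, |c| < h ∧ secondDifQuot e f h x = ∂_{e} (∂_{e} f) (x + c • e) := by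
  have d1 : ∀ t, HasDerivAt (fun t : ℝ => f (x + t • e)) (∂_{e} f (x + t • e)) t :=
    f.hasDerivAt_line x e
  have d1' : ∀ t, HasDerivAt (fun t : ℝ => f (x + (-t) • e)) (-∂_{e} f (x + (-t) • e)) t :=
    fun t => by simpa [Function.comp_def] using (d1 (-t)).scomp t (hasDerivAt_neg t)
  have d2 : ∀ t, HasDerivAt (fun t : ℝ => ∂_{e} f (x + t • e)) (∂_{e} (∂_{e} f) (x + t • e)) t :=
    (∂_{e} f).hasDerivAt_line x e
  have dψ : ∀ t, HasDerivAt (fun t : ℝ => f (x + t • e) + f (x + (-t) • e))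
      (∂_{e} f (x + t • e) + -∂_{e} f (x + (-t) • e)) t := fun t => (d1 t).add (d1' t)
  have dsq : ∀ t : ℝ, HasDerivAt (fun t : ℝ => t ^ 2) (2 * t) t := fun t => by
    simpa using hasDerivAt_pow 2 t
  obtain ⟨ξ, ⟨hξ0, hξh⟩, hξ⟩ := exists_ratio_hasDerivAt_eq_ratio_slope _ _ hh
    (fun t _ => (dψ t).continuousAt.continuousWithinAt) (fun t _ => dψ t) _ _
    (fun t _ => (dsq t).continuousAt.continuousWithinAt) (fun t _ => dsq t)
  obtain ⟨c, ⟨hc1, hc2⟩, hc⟩ := exists_hasDerivAt_eq_slope _ _ (show -ξ < ξ by linarith)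
    (fun t _ => (d2 t).continuousAt.continuousWithinAt) (fun t _ => d2 t)
  refine ⟨c, abs_lt.2 ⟨by linarith, by linarith⟩, ?_⟩
  rw [hc, secondDifQuot]
  simp only [neg_smul, ← sub_eq_add_neg, zero_smul, sub_zero, add_zero] at hξ ⊢
  field_simp
  have : ξ ≠ 0 := hξ0.ne'
  have h2 : f (x + h • e) + f (x - h • e) - 2 * f x =
      f (x + h • e) + f (x - h • e) - (f x + f x) := by ring
  rw [h2]
  simp only [sub_neg_eq_add]
  field_simp
  linarith

lemma SchwartzMap.exists_translate_le {E F : Type*} [NormedAddCommGroup E] [NormedSpace ℝ E]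
    [NormedAddCommGroup F] [NormedSpace ℝ F] (g : 𝓢(E, F)) (k : ℕ) :
    ∃ C, 0 ≤ C ∧ ∀ x y : E, ‖y‖ ≤ 1 → ‖g (x + y)‖ ≤ C * (1 + ‖x‖) ^ (-(k : ℝ)) := by
  refine ⟨2 ^ k * (2 ^ k * (Finset.Iic (k, 0)).sup
    (fun m => SchwartzMap.seminorm ℝ m.1 m.2) g), by positivity, fun x y hy => ?_⟩
  have h1 := g.one_add_le_sup_seminorm_apply (𝕜 := ℝ) (m := (k, 0)) le_rfl le_rfl (x + y)
  simp only [norm_iteratedFDeriv_zero] at h1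
  have h2 : 1 + ‖x‖ ≤ 2 * (1 + ‖x + y‖) := by
    have : ‖x‖ ≤ ‖x + y‖ + ‖y‖ := by simpa using norm_sub_le (x + y) y
    linarith [norm_nonneg (x + y)]
  rw [rpow_neg (by positivity), rpow_natCast, ← div_eq_mul_inv, le_div_iff₀ (by positivity)]
  calc ‖g (x + y)‖ * (1 + ‖x‖) ^ k ≤ ‖g (x + y)‖ * (2 * (1 + ‖x + y‖)) ^ k := by gcongr
    _ = 2 ^ k * ((1 + ‖x + y‖) ^ k * ‖g (x + y)‖) := by rw [mul_pow]; ring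
    _ ≤ _ := by gcongr

section

variable {E : Type*} [NormedAddCommGroup E] [InnerProductSpace ℝ E] [FiniteDimensional ℝ E]
  [MeasurableSpace E] [BorelSpace E]

lemma tendsto_integral_sum_secondDifQuot {κ : Type*} [Fintype κ] (e : κ → E)
    (he : ∀ j, ‖e j‖ = 1) (c : κ → ℝ) (f : 𝓢(E, ℝ)) {p : ℝ} (hp : 1 ≤ p) {h : ℕ → ℝ}
    (h0 : ∀ n, 0 < h n) (h1 : ∀ n, h n ≤ 1) (hlim : Filter.Tendsto h Filter.atTop (nhds 0)) :
    Filter.Tendsto (fun n => ∫ x, |∑ j, c j * secondDifQuot (e j) f (h n) x| ^ p) Filter.atTop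
      (nhds (∫ x, |∑ j, c j * ∂_{e j} (∂_{e j} f) x| ^ p)) := by
  have hp0 : 0 < p := by linarith
  choose t ht hteq using fun (n : ℕ) (j : κ) (x : E) => exists_secondDifQuot_eq f (e j) x (h0 n)
  set r : ℕ := Module.finrank ℝ E + 1 with hr
  choose C hC hCle using fun j => SchwartzMap.exists_translate_le (∂_{e j} (∂_{e j} f)) r
  set D := ∑ j, |c j| * C j with hD
  have hD0 : 0 ≤ D := Finset.sum_nonneg fun j _ => mul_nonneg (abs_nonneg _) (hC j)
  refine tendsto_integral_of_dominated_convergence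
    (fun x => D ^ p * (1 + ‖x‖) ^ (-((r : ℝ) * p))) (fun n => ?_) ?_ (fun n => ?_) ?_
  · refine Continuous.aestronglyMeasurable ?_
    refine Continuous.rpow_const ?_ fun _ => Or.inr hp0.le
    unfold secondDifQuot
    fun_prop
  · refine (integrable_one_add_norm ?_).const_mul _
    rw [hr]; push_cast
    nlinarith [(Nat.cast_nonneg (Module.finrank ℝ E) : (0 : ℝ) ≤ _)]
  · refine .of_forall fun x => ?_
    rw [Real.norm_of_nonneg (by positivity)]
    have : |∑ j, c j * secondDifQuot (e j) f (h n) x| ≤ D * (1 + ‖x‖) ^ (-(r : ℝ)) := by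
      rw [hD, Finset.sum_mul]
      refine (Finset.abs_sum_le_sum_abs _ _).trans (Finset.sum_le_sum fun j _ => ?_)
      rw [abs_mul, mul_assoc, hteq]
      gcongr
      refine hCle j x _ ?_
      rw [norm_smul, he, mul_one]
      exact (ht n j x).le.trans (h1 n)
    calc |∑ j, c j * secondDifQuot (e j) f (h n) x| ^ p
        ≤ (D * (1 + ‖x‖) ^ (-(r : ℝ))) ^ p := by gcongr
      _ = _ := by rw [mul_rpow hD0 (by positivity), ← rpow_mul (by positivity)]; ring_nf
  · refine .of_forall fun x => ?_
    refine Filter.Tendsto.rpow_const ?_ (Or.inr hp0.le)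
    refine Filter.Tendsto.abs (tendsto_finsetSum _ fun j _ => Filter.Tendsto.const_mul _ ?_)
    simp only [hteq]
    have h2 : Filter.Tendsto (fun n => x + t n j x • e j) Filter.atTop (nhds x) := by
      have : Filter.Tendsto (fun n => t n j x) Filter.atTop (nhds 0) :=
        squeeze_zero_norm (fun n => (ht n j x).le) hlim
      simpa using (this.smul_const (e j)).const_add x
    exact ((∂_{e j} (∂_{e j} f)).continuous.tendsto x).comp h2

variable (E) in
lemma SchwartzMap.integral_lineDeriv_lineDeriv_rpow_le_laplacian {p : ℝ} (hp : 1 < p) {ι : Type*}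
    [Fintype ι] [Nonempty ι] :
    ∃ K : ℝ, 0 < K ∧ ∀ (f : 𝓢(E, ℝ)) (b : OrthonormalBasis ι ℝ E) (i : ι),
      ∫ x, |∂_{b i} (∂_{b i} f) x| ^ p ≤ K * ∫ x, |Δ f x| ^ p := by
  obtain ⟨K, hK, hle⟩ := integral_symDif_symDif_rpow_le (ι := ι) (volume : Measure E) hp
  have hp0 : 0 < p := by linarith
  have hcard : (0 : ℝ) < Fintype.card ι := by exact_mod_cast Fintype.card_pos
  set s : ℝ := 2 * Fintype.card ι with hs
  have hs0 : 0 < s := by positivity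
  refine ⟨K * (s⁻¹) ^ p, by positivity, fun f b i => ?_⟩
  let h : ℕ → ℝ := fun n => 1 / ((n : ℝ) + 1) / 2
  have h0 : ∀ n, 0 < h n := fun n => by positivity
  have h1 : ∀ n, 2 * h n ≤ 1 := fun n => by
    simp only [h, mul_div_cancel₀ (1 / ((n : ℝ) + 1)) (two_ne_zero' ℝ)]
    rw [div_le_one (by positivity)]
    linarith [(Nat.cast_nonneg n : (0 : ℝ) ≤ n)]
  have hlim : Filter.Tendsto h Filter.atTop (nhds 0) := by
    simpa [h] using (tendsto_one_div_add_atTop_nhds_zero_nat (𝕜 := ℝ)).div_const 2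
  have hlim2 : Filter.Tendsto (fun n => 2 * h n) Filter.atTop (nhds 0) := by
    simpa using hlim.const_mul 2
  have L := tendsto_integral_sum_secondDifQuot (fun _ : Unit => b i) (fun _ => by simp)
    (fun _ => 1) f hp.le (fun n => by linarith [h0 n]) h1 hlim2
  have R := tendsto_integral_sum_secondDifQuot b (fun _ => by simp)
    (fun _ => s⁻¹) f hp.le h0 (fun n => by linarith [h0 n, h1 n]) hlim
  simp only [Finset.univ_unique, Finset.sum_singleton, one_mul] at L
  have e : ∀ x, ∑ j, s⁻¹ * ∂_{b j} (∂_{b j} f) x = s⁻¹ * Δ f x := fun x => by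
    rw [SchwartzMap.laplacian_eq_sum b, ← Finset.mul_sum]
    simp
  simp only [e, abs_mul, abs_of_pos (inv_pos.2 hs0)] at R
  simp only [mul_rpow (inv_pos.2 hs0).le (abs_nonneg _), integral_const_mul] at R
  rw [mul_assoc]
  refine le_of_tendsto_of_tendsto' L (R.const_mul K) fun n => ?_
  have hn := (h0 n).ne'
  have := hle f (f.memLp _) (fun j => h n • b j) i
  have e1 : ∀ x, symDif (h n • b i) (symDif (h n • b i) f) x =
      h n ^ 2 * secondDifQuot (b i) f (2 * h n) x := by
    intro x
    have a1 : x + h n • b i + h n • b i = x + (2 * h n) • b i := by module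
    have a2 : x - h n • b i - h n • b i = x - (2 * h n) • b i := by module
    simp only [symDif, secondDifQuot, a1, a2, add_sub_cancel_right, sub_add_cancel]
    field_simp
    ring
  have e2 : ∀ x, f x - latAvg (fun j => h n • b j) f x =
      -(h n ^ 2 * ∑ j, s⁻¹ * secondDifQuot (b j) f (h n) x) := by
    intro x
    have a1 : f x = ∑ j : ι, (Fintype.card ι : ℝ)⁻¹ * f x := by
      simp [hcard.ne']
    rw [latAvg, Finset.mul_sum, ← Finset.sum_neg_distrib]
    nth_rewrite 1 [a1]
    rw [← Finset.sum_sub_distrib]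
    refine Finset.sum_congr rfl fun j _ => ?_
    simp only [symAvg, secondDifQuot, hs]
    field_simp
    ring
  simp only [e1, e2, abs_neg, abs_mul, abs_of_nonneg (sq_nonneg (h n))] at this
  simp only [mul_rpow (sq_nonneg (h n)) (abs_nonneg _), integral_const_mul] at this
  have hpos : 0 < (h n ^ 2) ^ p := by have := h0 n; positivity
  refine le_of_mul_le_mul_left ?_ hpos
  calc _ ≤ _ := this
    _ = _ := by ring

end

section LqNorm

variable {α : Type*} [MeasurableSpace α] {F : Type*} [NormedAddCommGroup F] {μ : Measure α} {p : ℝ}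
  {f : α → F}

lemma LqNorm_nonneg : 0 ≤ LqNorm μ p f :=
  rpow_nonneg (integral_nonneg fun _ => rpow_nonneg (norm_nonneg _) _) _

lemma ofReal_LqNorm (hp : 0 < p) (hf : MemLp f (.ofReal p) μ) :
    ENNReal.ofReal (LqNorm μ p f) = eLpNorm f (.ofReal p) μ := by
  rw [hf.eLpNorm_eq_integral_rpow_norm (by simpa using hp) (by simp), LqNorm,
    ENNReal.toReal_ofReal hp.le, one_div]

lemma LqNorm_le_of_eLpNorm_le (hp : 0 < p) (hf : MemLp f (.ofReal p) μ) {c : ℝ} (hc : 0 ≤ c)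
    (h : eLpNorm f (.ofReal p) μ ≤ ENNReal.ofReal c) : LqNorm μ p f ≤ c := by
  rw [← ofReal_LqNorm hp hf] at h
  exact (ENNReal.ofReal_le_ofReal_iff hc).1 h

lemma LqNorm_le_sum (hp : 1 ≤ p) (hf : MemLp f (.ofReal p) μ) {κ G : Type*} [Fintype κ]
    [NormedAddCommGroup G] {g : κ → α → G} (hg : ∀ j, MemLp (g j) (.ofReal p) μ) {c : κ → ℝ}
    (hc : ∀ j, 0 ≤ c j) (h : ∀ x, ‖f x‖ ≤ ∑ j, c j * ‖g j x‖) :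
    LqNorm μ p f ≤ ∑ j, c j * LqNorm μ p (g j) := by
  have hp0 : 0 < p := by linarith
  refine LqNorm_le_of_eLpNorm_le hp0 hf
    (Finset.sum_nonneg fun j _ => mul_nonneg (hc j) LqNorm_nonneg) ?_
  have e : (fun x => ∑ j, c j * ‖g j x‖) = ∑ j, c j • fun x => ‖g j x‖ := by
    ext x; simp
  calc eLpNorm f (.ofReal p) μ ≤ eLpNorm (fun x => ∑ j, c j * ‖g j x‖) (.ofReal p) μ :=
        eLpNorm_mono_real h
    _ ≤ ∑ j, eLpNorm (c j • fun x => ‖g j x‖) (.ofReal p) μ := by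
        rw [e]
        exact eLpNorm_sum_le (fun j _ => (hg j).1.norm.const_smul _) (by simpa using hp)
    _ = ENNReal.ofReal (∑ j, c j * LqNorm μ p (g j)) := by
        rw [ENNReal.ofReal_sum_of_nonneg fun j _ => mul_nonneg (hc j) LqNorm_nonneg]
        refine Finset.sum_congr rfl fun j _ => ?_
        rw [eLpNorm_const_smul, eLpNorm_norm, ENNReal.ofReal_mul (hc j), ofReal_LqNorm hp0 (hg j),
          Real.enorm_eq_ofReal (hc j)]

lemma LqNorm_le_mul (hp : 1 ≤ p) (hf : MemLp f (.ofReal p) μ) {G : Type*}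
    [NormedAddCommGroup G] {g : α → G} (hg : MemLp g (.ofReal p) μ) {c : ℝ}
    (hc : 0 ≤ c) (h : ∀ x, ‖f x‖ ≤ c * ‖g x‖) : LqNorm μ p f ≤ c * LqNorm μ p g := by
  simpa using LqNorm_le_sum (κ := Unit) hp hf (fun _ => hg) (fun _ => hc) (by simpa using h)

end LqNorm

lemma SchwartzMap.lineDeriv_lineDeriv_apply {E F : Type*} [NormedAddCommGroup E] [NormedSpace ℝ E]
    [NormedAddCommGroup F] [NormedSpace ℝ F] (f : 𝓢(E, F)) (u v x : E) :
    ∂_{u} (∂_{v} f) x = fderiv ℝ (fderiv ℝ f) x u v := by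
  have h : DifferentiableAt ℝ (fderiv ℝ f) x :=
    ((f.smooth 2).fderiv_right (m := 1) (by norm_num)).differentiable (by norm_num) x
  rw [lineDerivOp_apply_eq_fderiv]
  change fderiv ℝ (fun y => fderiv ℝ f y v) x u = _
  rw [fderiv_clm_apply h (by fun_prop)]
  simp

lemma SchwartzMap.lineDeriv_comm {E F : Type*} [NormedAddCommGroup E] [NormedSpace ℝ E]
    [NormedAddCommGroup F] [NormedSpace ℝ F] (f : 𝓢(E, F)) (u v : E) :
    ∂_{u} (∂_{v} f) = ∂_{v} (∂_{u} f) := by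
  ext x
  rw [lineDeriv_lineDeriv_apply, lineDeriv_lineDeriv_apply]
  exact ((f.smooth 2).contDiffAt.isSymmSndFDerivAt (by simp)).eq u v

lemma SchwartzMap.lineDeriv_postcompCLM {E F G : Type*} [NormedAddCommGroup E] [NormedSpace ℝ E]
    [NormedAddCommGroup F] [NormedSpace ℝ F] [NormedAddCommGroup G] [NormedSpace ℝ G]
    (L : F →L[ℝ] G) (f : 𝓢(E, F)) (u : E) :
    ∂_{u} (f.postcompCLM L) = (∂_{u} f).postcompCLM L := by
  ext x
  rw [postcompCLM_apply, lineDerivOp_apply_eq_fderiv, lineDerivOp_apply_eq_fderiv]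
  change fderiv ℝ (fun y => L (f y)) x u = _
  rw [fderiv_fun_comp x (by fun_prop) f.differentiable.differentiableAt]
  simp

section

variable {E : Type*} [NormedAddCommGroup E] [InnerProductSpace ℝ E] [FiniteDimensional ℝ E]

lemma SchwartzMap.laplacian_postcompCLM {F G : Type*} [NormedAddCommGroup F] [NormedSpace ℝ F]
    [NormedAddCommGroup G] [NormedSpace ℝ G] (L : F →L[ℝ] G) (f : 𝓢(E, F)) :
    Δ (f.postcompCLM L) = (Δ f).postcompCLM L := by
  simp [laplacian_eq_sum (stdOrthonormalBasis ℝ E), lineDeriv_postcompCLM]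

variable [MeasurableSpace E] [BorelSpace E]

lemma SchwartzMap.LqNorm_le_sum {F G : Type*} [NormedAddCommGroup F] [NormedSpace ℝ F]
    [NormedAddCommGroup G] [NormedSpace ℝ G] {p : ℝ} (hp : 1 ≤ p) {κ : Type*} [Fintype κ]
    (f : 𝓢(E, F)) (g : κ → 𝓢(E, G)) {c : κ → ℝ} (hc : ∀ j, 0 ≤ c j)
    (h : ∀ x, ‖f x‖ ≤ ∑ j, c j * ‖g j x‖) :
    LqNorm volume p (fun x => f x) ≤ ∑ j, c j * LqNorm volume p (fun x => g j x) :=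
  _root_.LqNorm_le_sum hp (f.memLp _ _) (fun j => (g j).memLp _ _) hc h

lemma SchwartzMap.LqNorm_le_mul {F G : Type*} [NormedAddCommGroup F] [NormedSpace ℝ F]
    [NormedAddCommGroup G] [NormedSpace ℝ G] {p : ℝ} (hp : 1 ≤ p)
    (f : 𝓢(E, F)) (g : 𝓢(E, G)) {c : ℝ} (hc : 0 ≤ c) (h : ∀ x, ‖f x‖ ≤ c * ‖g x‖) :
    LqNorm volume p (fun x => f x) ≤ c * LqNorm volume p (fun x => g x) :=
  _root_.LqNorm_le_mul hp (f.memLp _ _) (g.memLp _ _) hc h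

variable (E) in
lemma SchwartzMap.LqNorm_lineDeriv_lineDeriv_self_le [Nontrivial E] {p : ℝ} (hp : 1 < p) :
    ∃ K : ℝ, 0 < K ∧ ∀ (f : 𝓢(E, ℂ)) (e : E), ‖e‖ = 1 →
      LqNorm volume p (fun x => ∂_{e} (∂_{e} f) x) ≤ K * LqNorm volume p (fun x => Δ f x) := by
  have : Nonempty (Fin (Module.finrank ℝ E)) := Fin.pos_iff_nonempty.1 Module.finrank_pos
  let i₀ : Fin (Module.finrank ℝ E) := Classical.arbitrary _
  have hp0 : 0 < p := by linarith
  obtain ⟨K, hK, hle⟩ := integral_lineDeriv_lineDeriv_rpow_le_laplacian E hp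
    (ι := Fin (Module.finrank ℝ E))
  have hreal : ∀ (f : 𝓢(E, ℝ)) (e : E), ‖e‖ = 1 →
      LqNorm volume p (fun x => ∂_{e} (∂_{e} f) x) ≤ K ^ (1 / p) * LqNorm volume p (fun x => Δ f x) := by
    intro f e he
    obtain ⟨b, hb⟩ := Orthonormal.exists_orthonormalBasis_extension_of_card_eq (𝕜 := ℝ) (E := E)
      (ι := Fin (Module.finrank ℝ E)) (by simp) (v := fun _ => e) (s := {i₀})
      ⟨fun _ => he, fun i j hij => (hij (Subsingleton.elim i j)).elim⟩
    have hbe : b i₀ = e := hb i₀ rfl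
    have := hle f b i₀
    rw [hbe] at this
    simp only [LqNorm]
    rw [← mul_rpow hK.le (integral_nonneg fun x => by positivity)]
    refine rpow_le_rpow (integral_nonneg fun x => by positivity) ?_ (by positivity)
    simpa using this
  refine ⟨2 * K ^ (1 / p), by positivity, fun f e he => ?_⟩
  have hre := hreal (f.postcompCLM Complex.reCLM) e he
  have him := hreal (f.postcompCLM Complex.imCLM) e he
  rw [lineDeriv_postcompCLM, lineDeriv_postcompCLM, laplacian_postcompCLM] at hre him
  have h1 : LqNorm volume p (fun x => ∂_{e} (∂_{e} f) x) ≤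
      ∑ j : Fin 2, 1 * LqNorm volume p (fun x => (![(∂_{e} (∂_{e} f)).postcompCLM Complex.reCLM,
        (∂_{e} (∂_{e} f)).postcompCLM Complex.imCLM] : Fin 2 → 𝓢(E, ℝ)) j x) := by
    refine LqNorm_le_sum hp.le _ _
      (fun _ => zero_le_one) fun x => ?_
    simpa [Fin.sum_univ_two] using Complex.norm_le_abs_re_add_abs_im (∂_{e} (∂_{e} f) x)
  have h2 : LqNorm volume p (fun x => (Δ f).postcompCLM Complex.reCLM x) ≤ 1 * LqNorm volume p (fun x => Δ f x) :=
    LqNorm_le_mul hp.le _ _ zero_le_one fun x => by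
      simpa using Complex.abs_re_le_norm (Δ f x)
  have h3 : LqNorm volume p (fun x => (Δ f).postcompCLM Complex.imCLM x) ≤ 1 * LqNorm volume p (fun x => Δ f x) :=
    LqNorm_le_mul hp.le _ _ zero_le_one fun x => by
      simpa using Complex.abs_im_le_norm (Δ f x)
  simp only [Fin.sum_univ_two, one_mul, Matrix.cons_val_zero, Matrix.cons_val_one] at h1 h2 h3
  calc _ ≤ _ := h1
    _ ≤ K ^ (1 / p) * LqNorm volume p (fun x => Δ f x) + K ^ (1 / p) * LqNorm volume p (fun x => Δ f x) :=
      add_le_add (hre.trans (by gcongr)) (him.trans (by gcongr))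
    _ = _ := by ring

variable (E) in
lemma SchwartzMap.LqNorm_lineDeriv_lineDeriv_le [Nontrivial E] {p : ℝ} (hp : 1 < p) :
    ∃ K : ℝ, 0 < K ∧ ∀ (f : 𝓢(E, ℂ)) (u v : E), ‖u‖ = 1 → ‖v‖ = 1 →
      LqNorm volume p (fun x => ∂_{u} (∂_{v} f) x) ≤ K * LqNorm volume p (fun x => Δ f x) := by
  obtain ⟨K, hK, hle⟩ := LqNorm_lineDeriv_lineDeriv_self_le E hp
  have hgen : ∀ (f : 𝓢(E, ℂ)) (e : E), ‖e‖ ≤ 2 →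
      LqNorm volume p (fun x => ∂_{e} (∂_{e} f) x) ≤ 4 * K * LqNorm volume p (fun x => Δ f x) := by
    intro f e he
    rcases eq_or_ne e 0 with rfl | h0
    · have : LqNorm volume p (fun x => ∂_{(0 : E)} (∂_{(0 : E)} f) x) ≤ 0 * LqNorm volume p (fun x => Δ f x) :=
        LqNorm_le_mul hp.le _ _ le_rfl fun x => by
          simp
      rw [zero_mul] at this
      exact this.trans (by have := LqNorm_nonneg (μ := volume) (p := p) (f := fun x => Δ f x); positivity)
    · have h1 := hle f (‖e‖⁻¹ • e) (by
        rw [norm_smul, norm_inv, norm_norm, inv_mul_cancel₀ (norm_ne_zero_iff.2 h0)])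
      have h2 : LqNorm volume p (fun x => ∂_{e} (∂_{e} f) x) ≤
          4 * LqNorm volume p (fun x => ∂_{‖e‖⁻¹ • e} (∂_{‖e‖⁻¹ • e} f) x) := by
        refine LqNorm_le_mul hp.le _ _ (by norm_num) fun x => ?_
        have he0 : 0 < ‖e‖ := norm_pos_iff.2 h0
        rw [lineDeriv_lineDeriv_apply, lineDeriv_lineDeriv_apply]
        simp only [map_smul, _root_.smul_apply, norm_smul, norm_inv, norm_norm]
        rw [← mul_assoc, ← mul_assoc]
        refine le_mul_of_one_le_left (norm_nonneg _) ?_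
        rw [mul_assoc, ← mul_inv, ← div_eq_mul_inv, one_le_div (by positivity)]
        nlinarith
      linarith
  refine ⟨2 * K, by positivity, fun f u v hu hv => ?_⟩
  have hp1 := hgen f (u + v) ((norm_add_le _ _).trans (by rw [hu, hv]; norm_num))
  have hp2 := hgen f (u - v) ((norm_sub_le _ _).trans (by rw [hu, hv]; norm_num))
  have h1 : LqNorm volume p (fun x => ∂_{u} (∂_{v} f) x) ≤
      ∑ j : Fin 2, 1 / 4 * LqNorm volume p (fun x => (![∂_{u + v} (∂_{u + v} f),
        ∂_{u - v} (∂_{u - v} f)] : Fin 2 → 𝓢(E, ℂ)) j x) := by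
    refine LqNorm_le_sum hp.le _ _
      (fun _ => by norm_num) fun x => ?_
    have hs : fderiv ℝ (fderiv ℝ f) x v u = fderiv ℝ (fderiv ℝ f) x u v := by
      rw [← lineDeriv_lineDeriv_apply, ← lineDeriv_lineDeriv_apply, lineDeriv_comm]
    have e : ∂_{u} (∂_{v} f) x = (1 / 4 : ℝ) • (∂_{u + v} (∂_{u + v} f) x) -
        (1 / 4 : ℝ) • ∂_{u - v} (∂_{u - v} f) x := by
      simp only [lineDeriv_lineDeriv_apply, map_add, map_sub, _root_.add_apply,
        _root_.sub_apply, hs]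
      module
    rw [e]
    refine (norm_sub_le _ _).trans ?_
    simp [Fin.sum_univ_two]
  simp only [Fin.sum_univ_two, Matrix.cons_val_zero, Matrix.cons_val_one] at h1
  linarith

end

/-- Composing a function of temperate growth taking values in a compact set of unique
differentiability with a smooth function on that set preserves temperate growth. -/
lemma Function.HasTemperateGrowth.comp_of_isCompact {D E F : Type*} [NormedAddCommGroup D]
    [NormedSpace ℝ D] [NormedAddCommGroup E] [NormedSpace ℝ E] [NormedAddCommGroup F]
    [NormedSpace ℝ F] {g : E → F} {f : D → E} {t : Set E} (ht : Set.range f ⊆ t)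
    (hc : IsCompact t) (hu : UniqueDiffOn ℝ t) (hg : ContDiffOn ℝ (⊤ : ℕ∞) g t)
    (hf : f.HasTemperateGrowth) : (g ∘ f).HasTemperateGrowth := by
  refine HasTemperateGrowth.comp' ht hu hg (fun n => ?_) hf
  have h : ∀ k : ℕ, ∃ C, ∀ x ∈ t, ‖iteratedFDerivWithin ℝ k g t x‖ ≤ C := fun k =>
    hc.exists_bound_of_continuousOn
      (hg.continuousOn_iteratedFDerivWithin (mod_cast le_top) hu)
  choose C hC using h
  refine ⟨0, ∑ k ∈ Finset.range (n + 1), |C k|, Finset.sum_nonneg fun _ _ => abs_nonneg _,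
    fun k hk x hx => ?_⟩
  rw [pow_zero, mul_one]
  exact ((hC k x hx).trans (le_abs_self _)).trans
    (Finset.single_le_sum (f := fun k => |C k|) (fun _ _ => abs_nonneg _)
      (Finset.mem_range.2 (by omega)))

lemma Complex.mem_slitPlane_add_ofReal {c : ℂ} (hc : c ∈ Complex.slitPlane) {r : ℝ}
    (hr : 0 ≤ r) : c + r ∈ Complex.slitPlane := by
  rw [Complex.mem_slitPlane_iff] at *
  rcases hc with h | h
  · left; simp; linarith
  · right; simpa using h

section

variable {E : Type*} [NormedAddCommGroup E] [InnerProductSpace ℝ E]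

/-- The Fourier symbol of the resolvent of the Laplacian has temperate growth. -/
lemma hasTemperateGrowth_inv_add_norm_sq {c : ℂ} (hc : c ∈ Complex.slitPlane) {b : ℝ}
    (hb : 0 < b) : Function.HasTemperateGrowth (fun x : E => (c + (b * ‖x‖ ^ 2 : ℝ))⁻¹) := by
  have hne : ∀ t : ℝ, t ∈ Set.Icc (0 : ℝ) 1 → (b : ℂ) + (c - b) * t ≠ 0 := by
    intro t ht h0
    rcases ht.1.eq_or_lt with h | h
    · rw [← h] at h0
      simp [hb.ne'] at h0
    · refine Complex.slitPlane_ne_zero (Complex.mem_slitPlane_add_ofReal hc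
        (r := b * (1 / t - 1)) (mul_nonneg hb.le ?_)) ?_
      · rw [sub_nonneg, le_div_iff₀ h]; linarith [ht.2]
      · have ht' : (t : ℂ) ≠ 0 := by exact_mod_cast h.ne'
        refine (mul_eq_zero.1 (?_ : (t : ℂ) * _ = 0)).resolve_left ht'
        rw [← h0]
        push_cast
        field_simp
        ring
  have hr : Set.range (fun x : E => (1 + ‖x‖ ^ 2) ^ (-1 : ℝ)) ⊆ Set.Icc 0 1 := by
    rintro _ ⟨x, rfl⟩
    exact ⟨by positivity, rpow_le_one_of_one_le_of_nonpos (by nlinarith [sq_nonneg ‖x‖])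
      (by norm_num)⟩
  have hd : ContDiffOn ℝ (⊤ : ℕ∞) (fun t : ℝ => (t : ℂ) * ((b : ℂ) + (c - b) * t)⁻¹)
      (Set.Icc 0 1) := by
    have h1 : ContDiff ℝ (⊤ : ℕ∞) (fun t : ℝ => (t : ℂ)) := Complex.ofRealCLM.contDiff
    exact h1.contDiffOn.mul
      ((contDiff_const.add (contDiff_const.mul h1)).contDiffOn.inv hne)
  have := Function.HasTemperateGrowth.comp_of_isCompact hr isCompact_Icc
    (uniqueDiffOn_Icc zero_lt_one) hd (Function.hasTemperateGrowth_one_add_norm_sq_rpow E (-1))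
  convert this using 1
  ext x
  have h1 : (0 : ℝ) < 1 + ‖x‖ ^ 2 := by positivity
  have h2 : ((1 + ‖x‖ ^ 2 : ℝ) : ℂ) ≠ 0 := by exact_mod_cast h1.ne'
  simp only [Function.comp, rpow_neg_one]
  rw [Complex.ofReal_inv, ← mul_inv_cancel_left₀ h2 ((b : ℂ) + _)⁻¹]
  rw [inv_mul_cancel_left₀ h2, ← mul_inv]
  congr 1
  rw [mul_add, mul_left_comm, mul_inv_cancel₀ h2]
  push_cast
  ring

end

section

lemma lintegral_rpow_le_measure_univ_rpow_mul {α : Type*} [MeasurableSpace α] {ν : Measure α}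
    [IsFiniteMeasure ν] {G : Type*} [NormedAddCommGroup G] {g : α → G}
    (hg : AEStronglyMeasurable g ν) {p : ℝ} (hp : 1 ≤ p) :
    (∫⁻ a, ‖g a‖ₑ ∂ν) ^ p ≤ ν Set.univ ^ (p - 1) * ∫⁻ a, ‖g a‖ₑ ^ p ∂ν := by
  have hp0 : 0 < p := by linarith
  have h := eLpNorm_le_eLpNorm_mul_rpow_measure_univ (μ := ν) (p := 1) (q := .ofReal p)
    (by simpa using hp) hg
  rw [eLpNorm_one_eq_lintegral_enorm, eLpNorm_eq_lintegral_rpow_enorm_toReal (by simpa using hp0)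
    (by simp), ENNReal.toReal_ofReal hp0.le] at h
  have h2 := ENNReal.rpow_le_rpow h hp0.le
  rwa [ENNReal.mul_rpow_of_nonneg _ _ hp0.le, ← ENNReal.rpow_mul, ← ENNReal.rpow_mul,
    one_div_mul_cancel hp0.ne', ENNReal.rpow_one, mul_comm,
    show (1 / (1 : ENNReal).toReal - 1 / p) * p = p - 1 by simp; field_simp] at h2

/-- **Minkowski's inequality** for averages of translates. -/
lemma eLpNorm_le_measure_univ_mul_of_enorm_le_lintegral_sub {E : Type*} [NormedAddCommGroup E]
    [MeasurableSpace E] [BorelSpace E] [SecondCountableTopology E] {μ : Measure E} [SFinite μ]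
    [μ.IsAddRightInvariant] {α : Type*} [MeasurableSpace α] {ν : Measure α} [IsFiniteMeasure ν]
    {φ : α → E} (hφ : Measurable φ) {F G : Type*} [NormedAddCommGroup F] [NormedAddCommGroup G]
    {f : E → F} (hf : Continuous f) {W : E → G} {p : ℝ} (hp : 1 ≤ p)
    (h : ∀ x, ‖W x‖ₑ ≤ ∫⁻ a, ‖f (x - φ a)‖ₑ ∂ν) :
    eLpNorm W (.ofReal p) μ ≤ ν Set.univ * eLpNorm f (.ofReal p) μ := by
  have hp0 : 0 < p := by linarith
  rw [eLpNorm_eq_lintegral_rpow_enorm_toReal (by simpa using hp0) (by simp),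
    eLpNorm_eq_lintegral_rpow_enorm_toReal (by simpa using hp0) (by simp),
    ENNReal.toReal_ofReal hp0.le]
  have hm : Measurable fun z : E × α => ‖f (z.1 - φ z.2)‖ₑ ^ p :=
    (hf.enorm.measurable.comp (measurable_fst.sub (hφ.comp measurable_snd))).pow_const p
  have key : ∫⁻ x, ‖W x‖ₑ ^ p ∂μ ≤ ν Set.univ ^ p * ∫⁻ x, ‖f x‖ₑ ^ p ∂μ := by
    calc ∫⁻ x, ‖W x‖ₑ ^ p ∂μ
        ≤ ∫⁻ x, ν Set.univ ^ (p - 1) * ∫⁻ a, ‖f (x - φ a)‖ₑ ^ p ∂ν ∂μ := by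
          refine lintegral_mono fun x => ?_
          have := lintegral_rpow_le_measure_univ_rpow_mul (ν := ν)
            (g := fun a => ‖f (x - φ a)‖)
            (hf.norm.measurable.comp (measurable_const.sub hφ)).aestronglyMeasurable hp
          simp only [enorm_norm] at this
          exact (ENNReal.rpow_le_rpow (h x) hp0.le).trans this
      _ = ν Set.univ ^ (p - 1) * ∫⁻ a, ∫⁻ x, ‖f (x - φ a)‖ₑ ^ p ∂μ ∂ν := by
          rw [lintegral_const_mul _ hm.lintegral_prod_right', lintegral_lintegral_swap]
          exact hm.aemeasurable
      _ = ν Set.univ ^ (p - 1) * ((∫⁻ x, ‖f x‖ₑ ^ p ∂μ) * ν Set.univ) := by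
          rw [← lintegral_const]
          congr 1
          refine lintegral_congr fun a => ?_
          exact lintegral_sub_right_eq_self (fun x => ‖f x‖ₑ ^ p) (φ a)
      _ = ν Set.univ ^ p * ∫⁻ x, ‖f x‖ₑ ^ p ∂μ := by
          rcases eq_or_ne (ν Set.univ) 0 with h0 | h0
          · rw [h0, ENNReal.zero_rpow_of_pos hp0]; simp
          · nth_rewrite 3 [show p = (p - 1) + 1 by ring]
            rw [ENNReal.rpow_add _ _ h0 (measure_ne_top _ _), ENNReal.rpow_one]
            ring
  calc (∫⁻ x, ‖W x‖ₑ ^ p ∂μ) ^ (1 / p)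
      ≤ (ν Set.univ ^ p * ∫⁻ x, ‖f x‖ₑ ^ p ∂μ) ^ (1 / p) :=
        ENNReal.rpow_le_rpow key (by positivity)
    _ = _ := by
        rw [ENNReal.mul_rpow_of_nonneg _ _ (by positivity), ← ENNReal.rpow_mul,
          mul_one_div_cancel hp0.ne', ENNReal.rpow_one]

end

section

variable {E : Type*} [NormedAddCommGroup E] [InnerProductSpace ℝ E] [FiniteDimensional ℝ E]
  [MeasurableSpace E] [BorelSpace E]

lemma SchwartzMap.LqNorm_le_of_enorm_le_lintegral_sub {F G : Type*} [NormedAddCommGroup F]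
    [NormedSpace ℝ F] [NormedAddCommGroup G] [NormedSpace ℝ G] {p : ℝ} (hp : 1 ≤ p)
    (W : 𝓢(E, G)) (f : 𝓢(E, F)) {α : Type*} [MeasurableSpace α] {ν : Measure α} {φ : α → E}
    (hφ : Measurable φ) {c : ℝ} (hc : 0 ≤ c) (hν : ν Set.univ ≤ ENNReal.ofReal c)
    (h : ∀ x, ‖W x‖ₑ ≤ ∫⁻ a, ‖f (x - φ a)‖ₑ ∂ν) :
    LqNorm volume p (fun x => W x) ≤ c * LqNorm volume p (fun x => f x) := by
  have : IsFiniteMeasure ν := ⟨hν.trans_lt ENNReal.ofReal_lt_top⟩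
  refine LqNorm_le_of_eLpNorm_le (by linarith) (W.memLp _ _) (mul_nonneg hc LqNorm_nonneg) ?_
  rw [ENNReal.ofReal_mul hc, ofReal_LqNorm (by linarith) (f.memLp _ _)]
  exact (eLpNorm_le_measure_univ_mul_of_enorm_le_lintegral_sub hφ f.continuous hp h).trans
    (mul_le_mul_left hν _)

end

section

variable {E : Type*} [NormedAddCommGroup E] [InnerProductSpace ℝ E]

variable (E) in
/-- The modulus of the heat kernel at complex time, as a function on `E`. -/
noncomputable def heatMajorant (b : ℂ) (y : E) : ℝ :=
  (π / ‖b‖) ^ (Module.finrank ℝ E / 2 : ℝ) * rexp (-(π ^ 2 * b.re / ‖b‖ ^ 2) * ‖y‖ ^ 2)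

lemma norm_heatKernel (b : ℂ) (y : E) :
    ‖(π / b) ^ (Module.finrank ℝ E / 2 : ℂ) * Complex.exp (-π ^ 2 * ‖y‖ ^ 2 / b)‖ =
      heatMajorant E b y := by
  have h1 : (Module.finrank ℝ E / 2 : ℂ) = ((Module.finrank ℝ E / 2 : ℝ) : ℂ) := by push_cast; rfl
  have h2 : (-π ^ 2 * ‖y‖ ^ 2 / b : ℂ) = ((-(π ^ 2 * ‖y‖ ^ 2) : ℝ) : ℂ) * b⁻¹ := by
    push_cast; ring
  rw [norm_mul, h1, Complex.norm_cpow_real, Complex.norm_exp, h2, Complex.re_ofReal_mul,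
    Complex.inv_re, heatMajorant, norm_div, Complex.norm_real, Real.norm_of_nonneg pi_pos.le,
    Complex.normSq_eq_norm_sq]
  congr 2
  ring

variable [FiniteDimensional ℝ E] [MeasurableSpace E] [BorelSpace E]

lemma lintegral_heatMajorant {b : ℂ} (hb : 0 < b.re) :
    ∫⁻ y : E, ENNReal.ofReal (heatMajorant E b y) =
      ENNReal.ofReal ((‖b‖ / b.re) ^ (Module.finrank ℝ E / 2 : ℝ)) := by
  have hb0 : 0 < ‖b‖ := hb.trans_le (Complex.re_le_norm b)
  have hpos : 0 < π ^ 2 * b.re / ‖b‖ ^ 2 := by positivity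
  have hi := GaussianFourier.integral_rexp_neg_mul_sq_norm (V := E) hpos
  have hInt : Integrable (fun y : E => rexp (-(π ^ 2 * b.re / ‖b‖ ^ 2) * ‖y‖ ^ 2)) := by
    by_contra hn
    rw [integral_undef hn] at hi
    exact (ne_of_lt (by positivity)) hi
  unfold heatMajorant
  rw [← ofReal_integral_eq_lintegral_ofReal (hInt.const_mul _)
    (Filter.Eventually.of_forall fun y => by positivity), integral_const_mul, hi,
    ← mul_rpow (by positivity) (by positivity)]
  congr 2
  field_simp

lemma SchwartzMap.integral_fourier_mul_gaussian (f : 𝓢(E, ℂ)) {b : ℂ} (hb : 0 < b.re) (x : E) :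
    ∫ η, 𝓕 f η * Complex.exp (-b * ‖η‖ ^ 2 + 2 * π * Complex.I * ⟪x, η⟫) =
      ∫ y, f y * ((π / b) ^ (Module.finrank ℝ E / 2 : ℂ) *
        Complex.exp (-π ^ 2 * ‖x - y‖ ^ 2 / b)) := by
  have hg : Integrable (fun η : E =>
      Complex.exp (-b * ‖η‖ ^ 2 + 2 * π * Complex.I * ⟪x, η⟫)) :=
    GaussianFourier.integrable_cexp_neg_mul_sq_norm_add hb _ _
  have := VectorFourier.integral_bilin_fourierIntegral_eq_flip (ContinuousLinearMap.mul ℂ ℂ)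
    (L := innerₗ E) (μ := volume) (ν := volume)
    continuous_fourierChar continuous_inner f.integrable hg
  simp only [ContinuousLinearMap.mul_apply'] at this
  rw [fourier_coe]
  refine this.trans ?_
  refine integral_congr_ae (Filter.Eventually.of_forall fun y => ?_)
  simp only
  rw [← fourier_gaussian_innerProductSpace' hb x y]
  congr 1
  simp [Real.fourier_eq, VectorFourier.fourierIntegral, real_inner_comm]

lemma SchwartzMap.enorm_integral_fourier_mul_gaussian_le (f : 𝓢(E, ℂ)) {b : ℂ} (hb : 0 < b.re)
    (x : E) :
    ‖∫ η, 𝓕 f η * Complex.exp (-b * ‖η‖ ^ 2 + 2 * π * Complex.I * ⟪x, η⟫)‖ₑ ≤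
      ∫⁻ y, ENNReal.ofReal (heatMajorant E b y) * ‖f (x - y)‖ₑ := by
  rw [f.integral_fourier_mul_gaussian hb]
  refine (enorm_integral_le_lintegral_enorm _).trans ?_
  rw [← lintegral_sub_left_eq_self _ x]
  refine lintegral_mono fun y => ?_
  rw [enorm_mul, sub_sub_cancel, mul_comm, ← ofReal_norm, norm_heatKernel]

end

section

variable {E : Type*} [NormedAddCommGroup E] [InnerProductSpace ℝ E] [FiniteDimensional ℝ E]
  [MeasurableSpace E] [BorelSpace E]

/-- The resolvent `(c - Δ)⁻¹` acting on Schwartz functions. -/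
noncomputable def SchwartzMap.resolvent (c : ℂ) : 𝓢(E, ℂ) →L[ℂ] 𝓢(E, ℂ) :=
  fourierMultiplierCLM ℂ (fun η : E => (c + ((2 * π) ^ 2 * ‖η‖ ^ 2 : ℝ))⁻¹)

namespace SchwartzMap

lemma fourier_resolvent_apply {c : ℂ} (hc : c ∈ Complex.slitPlane) (f : 𝓢(E, ℂ)) (η : E) :
    𝓕 (resolvent c f) η = (c + ((2 * π) ^ 2 * ‖η‖ ^ 2 : ℝ))⁻¹ * 𝓕 f η := by
  rw [resolvent, fourierMultiplierCLM_apply, FourierTransform.fourier_fourierInv_eq,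
    smulLeftCLM_apply_apply (hasTemperateGrowth_inv_add_norm_sq hc (by positivity)), smul_eq_mul]

lemma fourier_laplacian_apply (f : 𝓢(E, ℂ)) (η : E) :
    𝓕 (Δ f) η = -((2 * π) ^ 2 * ‖η‖ ^ 2 : ℝ) * 𝓕 f η := by
  rw [laplacian_eq_fourierMultiplierCLM, FourierTransform.fourier_smul, fourierMultiplierCLM_apply,
    FourierTransform.fourier_fourierInv_eq, smul_apply, smulLeftCLM_apply_apply (by fun_prop)]
  simp
  ring

lemma smul_resolvent_sub_laplacian {c : ℂ} (hc : c ∈ Complex.slitPlane) (f : 𝓢(E, ℂ)) :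
    c • resolvent c f - Δ (resolvent c f) = f := by
  rw [← FourierTransform.fourierInv_fourier_eq (F := 𝓢(E, ℂ))
    (c • resolvent c f - Δ (resolvent c f))]
  conv_rhs => rw [← FourierTransform.fourierInv_fourier_eq (F := 𝓢(E, ℂ)) f]
  congr 1
  ext η
  rw [sub_eq_add_neg, FourierTransform.fourier_add, FourierTransform.fourier_neg,
    FourierTransform.fourier_smul, add_apply, neg_apply, smul_apply, fourier_laplacian_apply,
    fourier_resolvent_apply hc]
  have h : c + ((2 * π) ^ 2 * ‖η‖ ^ 2 : ℝ) ≠ 0 :=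
    Complex.slitPlane_ne_zero (Complex.mem_slitPlane_add_ofReal hc (by positivity))
  generalize (((2 * π) ^ 2 * ‖η‖ ^ 2 : ℝ) : ℂ) = r at h ⊢
  rw [smul_eq_mul]
  field_simp

lemma fourier_lineDeriv_apply (f : 𝓢(E, ℂ)) (e η : E) :
    𝓕 (∂_{e} f) η = 2 * π * Complex.I * ⟪η, e⟫ * 𝓕 f η := by
  rw [fourier_lineDerivOp_eq, smul_apply, smulLeftCLM_apply_apply (by fun_prop)]
  simp [mul_assoc]

lemma resolvent_lineDeriv {c : ℂ} (hc : c ∈ Complex.slitPlane) (f : 𝓢(E, ℂ)) (e : E) :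
    resolvent c (∂_{e} f) = ∂_{e} (resolvent c f) := by
  rw [← FourierTransform.fourierInv_fourier_eq (F := 𝓢(E, ℂ)) (resolvent c (∂_{e} f)),
    ← FourierTransform.fourierInv_fourier_eq (F := 𝓢(E, ℂ)) (∂_{e} (resolvent c f))]
  congr 1
  ext η
  rw [fourier_resolvent_apply hc, fourier_lineDeriv_apply, fourier_lineDeriv_apply,
    fourier_resolvent_apply hc]
  ring

lemma eq_integral_fourier (f : 𝓢(E, ℂ)) (x : E) :
    f x = ∫ η, Complex.exp (2 * π * Complex.I * ⟪x, η⟫) * 𝓕 f η := by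
  conv_lhs => rw [← FourierTransform.fourierInv_fourier_eq (F := 𝓢(E, ℂ)) f]
  rw [fourierInv_coe, Real.fourierInv_eq']
  refine integral_congr_ae (Filter.Eventually.of_forall fun η => ?_)
  simp only [smul_eq_mul, real_inner_comm]
  congr 2
  push_cast
  ring

/-- Representation of the resolvent as a Laplace transform of the heat semigroup along the ray
spanned by `ω`. -/
lemma resolvent_apply_eq_integral {c ω : ℂ} (hc : c ∈ Complex.slitPlane) (hω : 0 < ω.re)
    (hcω : 0 < (c * ω).re) (f : 𝓢(E, ℂ)) (x : E) :
    resolvent c f x = ∫ s in Set.Ioi (0 : ℝ), ω * Complex.exp (-(c * ω) * s) *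
      ∫ η, 𝓕 f η * Complex.exp (-((2 * π) ^ 2 * ω * s) * ‖η‖ ^ 2 +
        2 * π * Complex.I * ⟪x, η⟫) := by
  have hω0 : ω ≠ 0 := by rintro rfl; simp at hω
  set H : E → ℝ → ℂ := fun η s => 𝓕 f η * Complex.exp (2 * π * Complex.I * ⟪x, η⟫) * ω *
    Complex.exp (-(c * ω + ((2 * π) ^ 2 * ‖η‖ ^ 2 : ℝ) * ω) * s) with hH
  have hre : ∀ η : E, 0 < (c * ω + ((2 * π) ^ 2 * ‖η‖ ^ 2 : ℝ) * ω).re := fun η => by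
    rw [Complex.add_re, Complex.re_ofReal_mul]
    exact add_pos_of_pos_of_nonneg hcω (by positivity)
  have hin : ∀ η : E, Complex.exp (2 * π * Complex.I * ⟪x, η⟫) * 𝓕 (resolvent c f) η =
      ∫ s in Set.Ioi (0 : ℝ), H η s := fun η => by
    have h0 : c + ((2 * π) ^ 2 * ‖η‖ ^ 2 : ℝ) ≠ 0 :=
      Complex.slitPlane_ne_zero (Complex.mem_slitPlane_add_ofReal hc (by positivity))
    simp only [hH]
    rw [integral_const_mul, integral_exp_mul_complex_Ioi (by
        rw [Complex.neg_re, neg_lt_zero]; exact hre η),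
      fourier_resolvent_apply hc, ← add_mul]
    simp only [Complex.ofReal_zero, mul_zero, Complex.exp_zero]
    field_simp
  have hInt : Integrable (Function.uncurry H) (volume.prod (volume.restrict (Set.Ioi 0))) := by
    have hexp : Integrable (fun s : ℝ => rexp (-(c * ω).re * s))
        (volume.restrict (Set.Ioi 0)) := by
      exact integrableOn_exp_mul_Ioi (by simpa using hcω) 0
    refine ((((𝓕 f).integrable (μ := volume)).norm.mul_const ‖ω‖).mul_prod hexp).mono' ?_ ?_
    · refine Continuous.aestronglyMeasurable ?_
      have := (𝓕 f).continuous
      simp only [hH, Function.uncurry_def]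
      fun_prop
    · have hmem : ∀ᵐ z : E × ℝ ∂(volume.prod (volume.restrict (Set.Ioi 0))), 0 < z.2 := by
        refine Measure.quasiMeasurePreserving_snd.ae (p := fun s : ℝ => 0 < s) ?_
        exact ae_restrict_mem measurableSet_Ioi
      filter_upwards [hmem] with z hz
      simp only [hH, Function.uncurry_def, norm_mul, Complex.norm_exp]
      have h1 : (2 * π * Complex.I * ⟪x, z.1⟫ : ℂ).re = 0 := by simp
      rw [h1, Real.exp_zero, mul_one]
      refine mul_le_mul_of_nonneg_left (Real.exp_le_exp.2 ?_) (by positivity)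
      rw [Complex.re_mul_ofReal, Complex.neg_re, Complex.add_re, Complex.re_ofReal_mul]
      have : 0 ≤ (2 * π) ^ 2 * ‖z.1‖ ^ 2 * ω.re := by positivity
      nlinarith
  rw [eq_integral_fourier (resolvent c f) x]
  simp_rw [hin]
  rw [integral_integral_swap hInt]
  refine integral_congr_ae (Filter.Eventually.of_forall fun s => ?_)
  simp only
  rw [← integral_const_mul]
  refine integral_congr_ae (Filter.Eventually.of_forall fun η => ?_)
  simp only [hH, Complex.exp_add]
  rw [show (-(c * ω + ((2 * π) ^ 2 * ‖η‖ ^ 2 : ℝ) * ω) * s : ℂ) =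
    -(c * ω) * s + -((2 * π) ^ 2 * ω * s) * ‖η‖ ^ 2 by push_cast; ring, Complex.exp_add]
  ring

lemma LqNorm_resolvent_le_of_re_pos {p : ℝ} (hp : 1 ≤ p) {c ω : ℂ} (hc : c ∈ Complex.slitPlane)
    (hω : 0 < ω.re) (hω1 : ‖ω‖ = 1) (hcω : 0 < (c * ω).re) (f : 𝓢(E, ℂ)) :
    LqNorm volume p (fun x => resolvent c f x) ≤
      (1 / ω.re) ^ (Module.finrank ℝ E / 2 : ℝ) / (c * ω).re * LqNorm volume p (fun x => f x) := by
  set b : ℝ → ℂ := fun s => (2 * π) ^ 2 * ω * s with hb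
  have hbre : ∀ s, (b s).re = (2 * π) ^ 2 * ω.re * s := fun s => by
    rw [hb]; simp only; rw [Complex.re_mul_ofReal]
    rw [show (2 * π : ℂ) ^ 2 = (((2 * π) ^ 2 : ℝ) : ℂ) by push_cast; ring, Complex.re_ofReal_mul]
  have hbn : ∀ s, 0 < s → ‖b s‖ = (2 * π) ^ 2 * s := fun s hs => by
    simp [hb, hω1, abs_of_pos hs, abs_of_pos pi_pos]
  have hbc : Continuous b := by fun_prop
  have hfm : Measurable fun x => ‖f x‖ₑ := f.continuous.enorm.measurable
  have hmeas : Measurable fun z : ℝ × E =>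
      ENNReal.ofReal (rexp (-(c * ω).re * z.1)) * ENNReal.ofReal (heatMajorant E (b z.1) z.2) := by
    unfold heatMajorant
    have := hbc.measurable
    fun_prop
  refine LqNorm_le_of_enorm_le_lintegral_sub hp (resolvent c f) f
    (ν := ((volume.restrict (Set.Ioi 0)).prod volume).withDensity fun z : ℝ × E =>
      ENNReal.ofReal (rexp (-(c * ω).re * z.1)) * ENNReal.ofReal (heatMajorant E (b z.1) z.2))
    (φ := Prod.snd) measurable_snd (by positivity) ?_ fun x => ?_
  · rw [withDensity_apply _ MeasurableSet.univ, Measure.restrict_univ,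
      lintegral_prod _ hmeas.aemeasurable]
    have hexp : IntegrableOn (fun s : ℝ => rexp (-(c * ω).re * s)) (Set.Ioi 0) :=
      integrableOn_exp_mul_Ioi (by simpa using hcω) 0
    calc _ = ∫⁻ s in Set.Ioi (0 : ℝ), ENNReal.ofReal (rexp (-(c * ω).re * s)) *
          ENNReal.ofReal ((1 / ω.re) ^ (Module.finrank ℝ E / 2 : ℝ)) := by
          refine setLIntegral_congr_fun measurableSet_Ioi fun s hs => ?_
          have hs0 : (0 : ℝ) < s := hs
          simp only
          rw [lintegral_const_mul _ (by unfold heatMajorant; fun_prop), lintegral_heatMajorant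
            (by rw [hbre]; positivity), hbn s hs0, hbre]
          congr 3
          field_simp
      _ = ENNReal.ofReal (1 / (c * ω).re) *
          ENNReal.ofReal ((1 / ω.re) ^ (Module.finrank ℝ E / 2 : ℝ)) := by
          rw [lintegral_mul_const _ (by fun_prop), ← ofReal_integral_eq_lintegral_ofReal hexp
            (Filter.Eventually.of_forall fun s => (Real.exp_pos _).le),
            integral_exp_mul_Ioi (neg_lt_zero.2 hcω), mul_zero, Real.exp_zero, neg_div_neg_eq]
      _ ≤ _ := by
          rw [← ENNReal.ofReal_mul (by positivity)]
          refine ENNReal.ofReal_le_ofReal (le_of_eq ?_)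
          ring
  · have hfz : Measurable fun z : ℝ × E => ‖f (x - z.2)‖ₑ :=
      hfm.comp (measurable_const.sub measurable_snd)
    have hfx : Measurable fun y : E => ‖f (x - y)‖ₑ :=
      hfm.comp (measurable_const.sub measurable_id)
    rw [lintegral_withDensity_eq_lintegral_mul _ hmeas
      hfz, lintegral_prod _ ?_,
      resolvent_apply_eq_integral hc hω hcω]
    · refine (enorm_integral_le_lintegral_enorm _).trans ?_
      refine setLIntegral_mono' measurableSet_Ioi fun s hs => ?_
      have hs0 : (0 : ℝ) < s := hs
      have h1 := enorm_integral_fourier_mul_gaussian_le f (b := b s)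
        (by rw [hbre]; positivity) x
      simp only [Pi.mul_apply, mul_assoc]
      have hm : Measurable fun y : E =>
          ENNReal.ofReal (heatMajorant E (b s) y) * ‖f (x - y)‖ₑ :=
        Measurable.mul (by unfold heatMajorant; fun_prop) hfx
      rw [lintegral_const_mul _ hm]
      rw [← mul_assoc, enorm_mul]
      refine mul_le_mul' (le_of_eq ?_) ?_
      · rw [← ofReal_norm, norm_mul, hω1, one_mul, Complex.norm_exp, Complex.re_mul_ofReal,
          Complex.neg_re]
      · simpa only [hb, mul_assoc] using h1
    · exact (hmeas.mul hfz).aemeasurable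

end SchwartzMap

end

section

variable {E : Type*} [NormedAddCommGroup E] [InnerProductSpace ℝ E] [FiniteDimensional ℝ E]
  [MeasurableSpace E] [BorelSpace E]

lemma Complex.mem_slitPlane_of_abs_arg_lt {c : ℂ} (hc : c ≠ 0) {σ : ℝ} (hσ : 0 ≤ σ)
    (hcσ : |c.arg| < π - σ) : c ∈ Complex.slitPlane := by
  refine Complex.mem_slitPlane_iff_arg.2 ⟨fun h => ?_, hc⟩
  rw [h, abs_of_pos pi_pos] at hcσ
  linarith

namespace SchwartzMap

lemma LqNorm_resolvent_le {p : ℝ} (hp : 1 ≤ p) {σ : ℝ} (hσ : σ ∈ Set.Ioo 0 (π / 2)) {c : ℂ}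
    (hc : c ≠ 0) (hcσ : |c.arg| < π - σ) (f : 𝓢(E, ℂ)) :
    ‖c‖ * LqNorm volume p (fun x => resolvent c f x) ≤
      (1 / sin (σ / 2)) ^ (Module.finrank ℝ E / 2 : ℝ) / sin (σ / 2) *
        LqNorm volume p (fun x => f x) := by
  have hs : 0 < sin (σ / 2) := sin_pos_of_pos_of_lt_pi (by linarith [hσ.1])
    (by linarith [hσ.2, pi_pos])
  set ω : ℂ := Complex.exp ((-(c.arg / 2) : ℝ) * Complex.I) with hω
  have hωre : ω.re = cos (c.arg / 2) := by rw [hω, Complex.exp_ofReal_mul_I_re, cos_neg]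
  have hcω : (c * ω).re = ‖c‖ * cos (c.arg / 2) := by
    conv_lhs => rw [← Complex.norm_mul_exp_arg_mul_I c]
    rw [hω, mul_assoc, ← Complex.exp_add, ← add_mul, ← Complex.ofReal_add, Complex.re_ofReal_mul,
      Complex.exp_ofReal_mul_I_re]
    congr 2
    ring
  have hcos : sin (σ / 2) ≤ cos (c.arg / 2) := by
    rw [← cos_abs (c.arg / 2), ← cos_pi_div_two_sub]
    have : |c.arg / 2| = |c.arg| / 2 := by rw [abs_div, abs_two]
    exact cos_le_cos_of_nonneg_of_le_pi (abs_nonneg _) (by linarith [hσ.1, pi_pos])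
      (by rw [this]; linarith)
  have hn : 0 < ‖c‖ := norm_pos_iff.2 hc
  have hcos0 := hs.trans_le hcos
  have h := LqNorm_resolvent_le_of_re_pos hp (Complex.mem_slitPlane_of_abs_arg_lt hc hσ.1.le hcσ)
    (hωre ▸ hcos0) (Complex.norm_exp_ofReal_mul_I _) (hcω ▸ by positivity) f
  rw [hcω, hωre] at h
  have hq := LqNorm_nonneg (μ := volume) (p := p) (f := fun x => f x)
  calc _ ≤ ‖c‖ * ((1 / cos (c.arg / 2)) ^ (Module.finrank ℝ E / 2 : ℝ) /
        (‖c‖ * cos (c.arg / 2)) * LqNorm volume p (fun x => f x)) := by gcongr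
    _ = (1 / cos (c.arg / 2)) ^ (Module.finrank ℝ E / 2 : ℝ) / cos (c.arg / 2) *
        LqNorm volume p (fun x => f x) := by field_simp
    _ ≤ _ := by gcongr

lemma mul_lineDeriv_eq {E : Type*} [NormedAddCommGroup E] [InnerProductSpace ℝ E]
    (W : 𝓢(E, ℂ)) (x e : E) (h : ℝ) :
    (h : ℂ) * ∂_{e} W x = W (x + h • e) - W x -
      ∫ r in (0 : ℝ)..h, ((h - r : ℝ) : ℂ) * ∂_{e} (∂_{e} W) (x + r • e) := by
  have hd : ∀ r : ℝ, HasDerivAt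
      (fun r : ℝ => W (x + r • e) + ((h - r : ℝ) : ℂ) * ∂_{e} W (x + r • e))
      (((h - r : ℝ) : ℂ) * ∂_{e} (∂_{e} W) (x + r • e)) r := by
    intro r
    have h1 : HasDerivAt (fun r : ℝ => ((h - r : ℝ) : ℂ)) ((-1 : ℝ) : ℂ) r :=
      ((hasDerivAt_id r).const_sub h).ofReal_comp
    refine ((W.hasDerivAt_line x e r).add
      (h1.mul ((∂_{e} W).hasDerivAt_line x e r))).congr_deriv ?_
    push_cast
    ring
  have hc : Continuous fun r : ℝ => ((h - r : ℝ) : ℂ) * ∂_{e} (∂_{e} W) (x + r • e) := by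
    have := (∂_{e} (∂_{e} W)).continuous
    fun_prop
  rw [intervalIntegral.integral_eq_sub_of_hasDerivAt (fun r _ => hd r) (hc.intervalIntegrable _ _)]
  simp

lemma norm_lineDeriv_le {E : Type*} [NormedAddCommGroup E] [InnerProductSpace ℝ E]
    (W : 𝓢(E, ℂ)) (x e : E) {h : ℝ} (hh : 0 < h) :
    ‖∂_{e} W x‖ ≤ h⁻¹ * (‖W (x + h • e)‖ + ‖W x‖) +
      ∫ r in (0 : ℝ)..h, ‖∂_{e} (∂_{e} W) (x + r • e)‖ := by
  have hc := (∂_{e} (∂_{e} W)).continuous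
  have h1 : ‖∫ r in (0 : ℝ)..h, ((h - r : ℝ) : ℂ) * ∂_{e} (∂_{e} W) (x + r • e)‖ ≤
      ∫ r in (0 : ℝ)..h, h * ‖∂_{e} (∂_{e} W) (x + r • e)‖ := by
    refine intervalIntegral.norm_integral_le_of_norm_le hh.le
      (Filter.Eventually.of_forall fun r hr => ?_)
      (Continuous.intervalIntegrable (by fun_prop) _ _)
    rw [norm_mul, Complex.norm_real, Real.norm_of_nonneg (by linarith [hr.2])]
    gcongr
    linarith [hr.1]
  rw [intervalIntegral.integral_const_mul] at h1
  have h2 : h * ‖∂_{e} W x‖ ≤ (‖W (x + h • e)‖ + ‖W x‖) +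
      h * ∫ r in (0 : ℝ)..h, ‖∂_{e} (∂_{e} W) (x + r • e)‖ := by
    calc h * ‖∂_{e} W x‖ = ‖(h : ℂ) * ∂_{e} W x‖ := by
          rw [norm_mul, Complex.norm_real, Real.norm_of_nonneg hh.le]
      _ ≤ _ := by
          rw [mul_lineDeriv_eq]
          exact (norm_sub_le _ _).trans (add_le_add (norm_sub_le _ _) h1)
  rw [← mul_le_mul_iff_right₀ hh, mul_add, mul_inv_cancel_left₀ hh.ne']
  exact h2

/-- An interpolation inequality between a function and its second derivative. -/
lemma LqNorm_lineDeriv_le {p : ℝ} (hp : 1 ≤ p) (W : 𝓢(E, ℂ)) (e : E) {h : ℝ} (hh : 0 < h) :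
    LqNorm volume p (fun x => ∂_{e} W x) ≤ 2 * h⁻¹ * LqNorm volume p (fun x => W x) +
      h * LqNorm volume p (fun x => ∂_{e} (∂_{e} W) x) := by
  have hp0 : 0 < p := by linarith
  have n1 := LqNorm_nonneg (μ := volume) (p := p) (f := fun x => W x)
  have n2 := LqNorm_nonneg (μ := volume) (p := p) (f := fun x => ∂_{e} (∂_{e} W) x)
  have hW := W.continuous
  have hc := (∂_{e} (∂_{e} W)).continuous
  set A : E → ℝ := fun x => h⁻¹ * (‖W (x + h • e)‖ + ‖W x‖) with hA
  set B : E → ℝ := fun x => ∫ r in (0 : ℝ)..h, ‖∂_{e} (∂_{e} W) (x + r • e)‖ with hB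
  have hAc : Continuous A := by fun_prop
  have hBc : Continuous B := by
    refine intervalIntegral.continuous_parametric_intervalIntegral_of_continuous' ?_ _ _
    fun_prop
  have eA : eLpNorm A (.ofReal p) volume ≤
      ENNReal.ofReal (2 * h⁻¹ * LqNorm volume p (fun x => W x)) := by
    rw [ENNReal.ofReal_mul (by positivity), ofReal_LqNorm hp0 (W.memLp _ _)]
    have hfin : IsFiniteMeasure (ENNReal.ofReal h⁻¹ • (Measure.dirac (-(h • e)) +
        Measure.dirac (0 : E))) := Measure.smul_finite _ ENNReal.ofReal_ne_top
    refine (eLpNorm_le_measure_univ_mul_of_enorm_le_lintegral_sub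
      (ν := ENNReal.ofReal h⁻¹ • (Measure.dirac (-(h • e)) + Measure.dirac (0 : E)))
      measurable_id hW hp fun x => ?_).trans (mul_le_mul_left (le_of_eq ?_) _)
    · rw [lintegral_smul_measure, lintegral_add_measure, lintegral_dirac, lintegral_dirac]
      simp only [id, sub_neg_eq_add, sub_zero, smul_eq_mul, hA]
      rw [Real.enorm_eq_ofReal (by positivity), ENNReal.ofReal_mul (by positivity),
        ENNReal.ofReal_add (by positivity) (by positivity), ofReal_norm, ofReal_norm]
    · rw [mul_comm (2 : ℝ), ENNReal.ofReal_mul (by positivity)]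
      simp [mul_two]
  have eB : eLpNorm B (.ofReal p) volume ≤
      ENNReal.ofReal (h * LqNorm volume p (fun x => ∂_{e} (∂_{e} W) x)) := by
    rw [ENNReal.ofReal_mul (by positivity), ofReal_LqNorm hp0 ((∂_{e} (∂_{e} W)).memLp _ _)]
    refine (eLpNorm_le_measure_univ_mul_of_enorm_le_lintegral_sub
      (ν := volume.restrict (Set.Ioc 0 h)) (φ := fun r : ℝ => -(r • e))
      (by fun_prop) hc hp fun x => ?_).trans (mul_le_mul_left (le_of_eq ?_) _)
    · simp only [hB, sub_neg_eq_add]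
      rw [intervalIntegral.integral_of_le hh.le]
      refine (enorm_integral_le_lintegral_enorm _).trans (le_of_eq ?_)
      simp only [enorm_norm]
    · simp
  refine LqNorm_le_of_eLpNorm_le hp0 ((∂_{e} W).memLp _ _) (by positivity) ?_
  rw [ENNReal.ofReal_add (by positivity) (by positivity)]
  calc _ ≤ eLpNorm (A + B) (.ofReal p) volume :=
        eLpNorm_mono_real fun x => W.norm_lineDeriv_le x e hh
    _ ≤ _ := eLpNorm_add_le hAc.aestronglyMeasurable hBc.aestronglyMeasurable (by simpa using hp)
    _ ≤ _ := add_le_add eA eB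

variable (E) in
lemma exists_LqNorm_resolvent_le [Nontrivial E] {p : ℝ} (hp : 1 < p) {σ : ℝ}
    (hσ : σ ∈ Set.Ioo 0 (π / 2)) :
    ∃ M : ℝ, 0 < M ∧ ∀ c : ℂ, c ≠ 0 → |c.arg| < π - σ → ∀ f : 𝓢(E, ℂ),
      ‖c‖ * LqNorm volume p (fun x => resolvent c f x) ≤ M * LqNorm volume p (fun x => f x) ∧
      ∀ u v : E, ‖u‖ = 1 → ‖v‖ = 1 →
        ‖c‖ ^ (1 / 2 : ℝ) * LqNorm volume p (fun x => ∂_{u} (resolvent c f) x) ≤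
          M * LqNorm volume p (fun x => f x) ∧
        LqNorm volume p (fun x => ∂_{u} (∂_{v} (resolvent c f)) x) ≤
          M * LqNorm volume p (fun x => f x) := by
  obtain ⟨K, hK, hKle⟩ := LqNorm_lineDeriv_lineDeriv_le E hp
  have hs : 0 < sin (σ / 2) := sin_pos_of_pos_of_lt_pi (by linarith [hσ.1])
    (by linarith [hσ.2, pi_pos])
  set A := (1 / sin (σ / 2)) ^ (Module.finrank ℝ E / 2 : ℝ) / sin (σ / 2) with hA
  have hA0 : 0 < A := by positivity
  refine ⟨2 * A + K * (1 + A), by positivity, fun c hc hcσ f => ?_⟩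
  set Q := LqNorm volume p (fun x => f x) with hQ
  have hQ0 : 0 ≤ Q := LqNorm_nonneg
  have h1 : ‖c‖ * LqNorm volume p (fun x => resolvent c f x) ≤ A * Q :=
    LqNorm_resolvent_le hp.le hσ hc hcσ f
  have hΔ : LqNorm volume p (fun x => Δ (resolvent c f) x) ≤ (1 + A) * Q := by
    have h := LqNorm_le_sum hp.le (Δ (resolvent c f))
      (![resolvent c f, f] : Fin 2 → 𝓢(E, ℂ)) (c := ![‖c‖, 1])
      (by simp [Fin.forall_fin_two]) fun x => by
        have := smul_resolvent_sub_laplacian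
          (Complex.mem_slitPlane_of_abs_arg_lt hc hσ.1.le hcσ) f
        have e : Δ (resolvent c f) x = c * resolvent c f x - f x := by
          have hx := DFunLike.congr_fun this x
          rw [sub_apply, smul_apply, smul_eq_mul] at hx
          linear_combination -hx
        rw [e]
        refine (norm_sub_le _ _).trans ?_
        simp [Fin.sum_univ_two]
    simp only [Fin.sum_univ_two, Matrix.cons_val_zero, Matrix.cons_val_one, one_mul] at h
    linarith
  have h2 : ∀ u v : E, ‖u‖ = 1 → ‖v‖ = 1 →
      LqNorm volume p (fun x => ∂_{u} (∂_{v} (resolvent c f)) x) ≤ K * (1 + A) * Q := by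
    intro u v hu hv
    refine (hKle _ u v hu hv).trans ?_
    rw [mul_assoc]
    gcongr
  have hn : 0 < ‖c‖ := norm_pos_iff.2 hc
  refine ⟨h1.trans (by gcongr; nlinarith), fun u v hu hv =>
    ⟨?_, (h2 u v hu hv).trans (by gcongr; nlinarith)⟩⟩
  have hr : 0 < ‖c‖ ^ (1 / 2 : ℝ) := by positivity
  have hrr : ‖c‖ ^ (1 / 2 : ℝ) * ‖c‖ ^ (1 / 2 : ℝ) = ‖c‖ := by
    rw [← rpow_add hn]; norm_num
  set r := ‖c‖ ^ (1 / 2 : ℝ)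
  have h3 := LqNorm_lineDeriv_le hp.le (resolvent c f) u (h := r⁻¹) (by positivity)
  rw [inv_inv] at h3
  calc _ ≤ r * (2 * r * LqNorm volume p (fun x => resolvent c f x) +
        r⁻¹ * LqNorm volume p (fun x => ∂_{u} (∂_{u} (resolvent c f)) x)) := by gcongr
    _ = 2 * (‖c‖ * LqNorm volume p (fun x => resolvent c f x)) +
        LqNorm volume p (fun x => ∂_{u} (∂_{u} (resolvent c f)) x) := by
        rw [← hrr]; field_simp
    _ ≤ 2 * (A * Q) + K * (1 + A) * Q := by
        gcongr
        exact h2 u u hu hu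
    _ = _ := by ring

end SchwartzMap

end

section

variable {ι : Type*} [Fintype ι]

lemma EuclideanSpace.opNorm_le_sum_single [DecidableEq ι] {G : Type*} [NormedAddCommGroup G]
    [NormedSpace ℝ G] (L : EuclideanSpace ℝ ι →L[ℝ] G) : ‖L‖ ≤ ∑ k, ‖L (EuclideanSpace.single k 1)‖ := by
  refine L.opNorm_le_bound (Finset.sum_nonneg fun _ _ => norm_nonneg _) fun v => ?_
  have h : v = ∑ k, v k • EuclideanSpace.single k (1 : ℝ) := by
    simpa using ((EuclideanSpace.basisFun ι ℝ).sum_repr v).symm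
  conv_lhs => rw [h, map_sum]
  refine (norm_sum_le _ _).trans ?_
  rw [Finset.sum_mul]
  refine Finset.sum_le_sum fun k _ => ?_
  rw [map_smul, norm_smul, mul_comm]
  gcongr
  exact PiLp.norm_apply_le v k

namespace SchwartzMap

lemma norm_fderiv_le_sum [DecidableEq ι] (V : 𝓢(EuclideanSpace ℝ ι, ℂ)) (x : EuclideanSpace ℝ ι) :
    ‖fderiv ℝ V x‖ ≤ ∑ k : ι, ‖∂_{EuclideanSpace.single k (1 : ℝ)} V x‖ :=
  EuclideanSpace.opNorm_le_sum_single _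

lemma norm_iteratedFDeriv_two {E F : Type*} [NormedAddCommGroup E] [NormedSpace ℝ E]
    [NormedAddCommGroup F] [NormedSpace ℝ F] (f : E → F) (x : E) :
    ‖iteratedFDeriv ℝ 2 f x‖ = ‖fderiv ℝ (fderiv ℝ f) x‖ := by
  rw [← norm_iteratedFDeriv_fderiv (n := 1), norm_iteratedFDeriv_one]

lemma norm_iteratedFDeriv_two_le_sum [DecidableEq ι] (V : 𝓢(EuclideanSpace ℝ ι, ℂ))
    (x : EuclideanSpace ℝ ι) :
    ‖iteratedFDeriv ℝ 2 V x‖ ≤ ∑ z : ι × ι,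
      ‖∂_{EuclideanSpace.single z.1 (1 : ℝ)} (∂_{EuclideanSpace.single z.2 (1 : ℝ)} V) x‖ := by
  rw [norm_iteratedFDeriv_two, Fintype.sum_prod_type]
  refine (EuclideanSpace.opNorm_le_sum_single _).trans (Finset.sum_le_sum fun j _ => ?_)
  refine (EuclideanSpace.opNorm_le_sum_single _).trans (Finset.sum_le_sum fun k _ => ?_)
  rw [lineDeriv_lineDeriv_apply]

lemma memLp_fderiv (V : 𝓢(EuclideanSpace ℝ ι, ℂ)) (p : ENNReal) :
    MemLp (fun x => fderiv ℝ V x) p volume :=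
  (fderivCLM ℝ (EuclideanSpace ℝ ι) ℂ V).memLp p volume

lemma memLp_iteratedFDeriv_two (V : 𝓢(EuclideanSpace ℝ ι, ℂ)) (p : ENNReal) :
    MemLp (fun x => iteratedFDeriv ℝ 2 V x) p volume := by
  refine MemLp.congr_norm ((fderivCLM ℝ (EuclideanSpace ℝ ι) _
    (fderivCLM ℝ (EuclideanSpace ℝ ι) ℂ V)).memLp p volume) ?_
    (Filter.Eventually.of_forall fun x => (norm_iteratedFDeriv_two V x).symm)
  exact ((V.smooth 2).continuous_iteratedFDeriv le_rfl).aestronglyMeasurable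

lemma LqNorm_fderiv_le_sum [DecidableEq ι] {p : ℝ} (hp : 1 ≤ p) (V : 𝓢(EuclideanSpace ℝ ι, ℂ)) :
    LqNorm volume p (fun x => fderiv ℝ V x) ≤
      ∑ k : ι, LqNorm volume p (fun x => ∂_{EuclideanSpace.single k (1 : ℝ)} V x) := by
  simpa using _root_.LqNorm_le_sum hp (V.memLp_fderiv _) (c := fun _ => 1)
    (fun k : ι => (∂_{EuclideanSpace.single k (1 : ℝ)} V).memLp (.ofReal p) volume)
    (fun _ => zero_le_one) (by simpa using V.norm_fderiv_le_sum)

lemma LqNorm_iteratedFDeriv_two_le_sum [DecidableEq ι] {p : ℝ} (hp : 1 ≤ p)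
    (V : 𝓢(EuclideanSpace ℝ ι, ℂ)) :
    LqNorm volume p (fun x => iteratedFDeriv ℝ 2 V x) ≤ ∑ z : ι × ι, LqNorm volume p (fun x =>
      ∂_{EuclideanSpace.single z.1 (1 : ℝ)} (∂_{EuclideanSpace.single z.2 (1 : ℝ)} V) x) := by
  simpa using _root_.LqNorm_le_sum hp (V.memLp_iteratedFDeriv_two _) (c := fun _ => 1)
    (fun z : ι × ι => (∂_{EuclideanSpace.single z.1 (1 : ℝ)}
      (∂_{EuclideanSpace.single z.2 (1 : ℝ)} V)).memLp (.ofReal p) volume)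
    (fun _ => zero_le_one) (by simpa using V.norm_iteratedFDeriv_two_le_sum)

/-- The `j`-th component of a Schwartz vector field. -/
noncomputable def component (F : 𝓢(EuclideanSpace ℝ ι, EuclideanSpace ℂ ι)) (j : ι) :
    𝓢(EuclideanSpace ℝ ι, ℂ) :=
  F.postcompCLM (PiLp.proj (𝕜 := ℝ) 2 (fun _ : ι => ℂ) j)

@[simp]
lemma component_apply (F : 𝓢(EuclideanSpace ℝ ι, EuclideanSpace ℂ ι)) (j : ι)
    (x : EuclideanSpace ℝ ι) : F.component j x = F x j := rfl

/-- The divergence of a Schwartz vector field. -/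
noncomputable def divergence [DecidableEq ι] (F : 𝓢(EuclideanSpace ℝ ι, EuclideanSpace ℂ ι)) :
    𝓢(EuclideanSpace ℝ ι, ℂ) :=
  ∑ j, ∂_{EuclideanSpace.single j (1 : ℝ)} (F.component j)

lemma divergence_apply [DecidableEq ι] (F : 𝓢(EuclideanSpace ℝ ι, EuclideanSpace ℂ ι))
    (x : EuclideanSpace ℝ ι) :
    F.divergence x =
      ∑ j, fderiv ℝ (fun y => F y j) x (EuclideanSpace.single j (1 : ℝ)) := by
  rw [divergence, sum_apply]
  rfl

lemma LqNorm_component_le {p : ℝ} (hp : 1 ≤ p)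
    (F : 𝓢(EuclideanSpace ℝ ι, EuclideanSpace ℂ ι)) (j : ι) :
    LqNorm volume p (fun x => F.component j x) ≤ LqNorm volume p (fun x => F x) := by
  simpa using LqNorm_le_mul hp (F.component j) F zero_le_one fun x => by
    simpa using PiLp.norm_apply_le (F x) j

lemma resolvent_divergence [DecidableEq ι] {c : ℂ} (hc : c ∈ Complex.slitPlane)
    (F : 𝓢(EuclideanSpace ℝ ι, EuclideanSpace ℂ ι)) :
    resolvent c F.divergence =
      ∑ j, ∂_{EuclideanSpace.single j (1 : ℝ)} (resolvent c (F.component j)) := by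
  rw [divergence, map_sum]
  exact Finset.sum_congr rfl fun j _ => resolvent_lineDeriv hc _ _

lemma lineDeriv_resolvent_divergence [DecidableEq ι] {c : ℂ} (hc : c ∈ Complex.slitPlane)
    (F : 𝓢(EuclideanSpace ℝ ι, EuclideanSpace ℂ ι)) (e : EuclideanSpace ℝ ι) :
    ∂_{e} (resolvent c F.divergence) =
      ∑ j, ∂_{e} (∂_{EuclideanSpace.single j (1 : ℝ)} (resolvent c (F.component j))) := by
  rw [resolvent_divergence hc]
  exact map_sum (LineDeriv.lineDerivOpCLM ℝ 𝓢(EuclideanSpace ℝ ι, ℂ) e) _ _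

lemma fourier_resolvent_divergence_apply [DecidableEq ι] {c : ℂ} (hc : c ∈ Complex.slitPlane)
    (F : 𝓢(EuclideanSpace ℝ ι, EuclideanSpace ℂ ι)) (η : EuclideanSpace ℝ ι) :
    𝓕 (resolvent c F.divergence) η = (c + ((2 * π) ^ 2 * ‖η‖ ^ 2 : ℝ))⁻¹ *
      ∑ j, 2 * π * Complex.I * η j * 𝓕 (F.component j) η := by
  rw [fourier_resolvent_apply hc, divergence]
  have h : 𝓕 (∑ j, ∂_{EuclideanSpace.single j (1 : ℝ)} (F.component j)) =
      ∑ j, 𝓕 (∂_{EuclideanSpace.single j (1 : ℝ)} (F.component j)) :=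
    map_sum (FourierTransform.fourierCLM ℂ 𝓢(EuclideanSpace ℝ ι, ℂ)) _ _
  rw [h, sum_apply]
  congr 1
  refine Finset.sum_congr rfl fun j _ => ?_
  rw [fourier_lineDeriv_apply]
  simp [EuclideanSpace.inner_single_right]

lemma integral_exp_smul_apply (F : 𝓢(EuclideanSpace ℝ ι, EuclideanSpace ℂ ι)) (j : ι)
    (ξ : EuclideanSpace ℝ ι) :
    (∫ y, Complex.exp (-Complex.I * (⟪y, ξ⟫ : ℂ)) • F y) j =
      𝓕 (F.component j) ((2 * π)⁻¹ • ξ) := by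
  have hInt : Integrable fun y => Complex.exp (-Complex.I * (⟪y, ξ⟫ : ℂ)) • F y := by
    refine (F.integrable (μ := volume)).norm.mono' ?_ (Filter.Eventually.of_forall fun y => ?_)
    · have := F.continuous
      exact Continuous.aestronglyMeasurable (by fun_prop)
    · rw [norm_smul, Complex.norm_exp]
      simp
  have h := (PiLp.proj (𝕜 := ℝ) 2 (fun _ : ι => ℂ) j).integral_comp_comm hInt
  rw [PiLp.proj_apply] at h
  rw [← h, fourier_coe, Real.fourier_eq']
  refine integral_congr_ae (Filter.Eventually.of_forall fun y => ?_)
  simp only [PiLp.proj_apply, PiLp.smul_apply, component_apply, inner_smul_right]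
  congr 2
  push_cast
  have : (π : ℂ) ≠ 0 := by exact_mod_cast pi_ne_zero
  field_simp

/-- The Fourier integrand of the resolvent, in the normalisation without `2π` in the exponent,
is a rescaling of the one in the normalisation of Mathlib. -/
lemma fourier_integrand_eq [DecidableEq ι] {c : ℂ} (hc : c ∈ Complex.slitPlane)
    (F : 𝓢(EuclideanSpace ℝ ι, EuclideanSpace ℂ ι)) (x ξ : EuclideanSpace ℝ ι) :
    Complex.exp (Complex.I * (⟪x, ξ⟫ : ℂ)) *
        (Complex.I * ∑ j, (ξ j : ℂ) *
          (∫ y, Complex.exp (-Complex.I * (⟪y, ξ⟫ : ℂ)) • F y) j) / (c + (‖ξ‖ : ℂ) ^ 2) =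
      Complex.exp (2 * π * Complex.I * ⟪x, (2 * π)⁻¹ • ξ⟫) *
        𝓕 (resolvent c F.divergence) ((2 * π)⁻¹ • ξ) := by
  have hpi : (π : ℂ) ≠ 0 := by exact_mod_cast pi_ne_zero
  rw [fourier_resolvent_divergence_apply hc, inner_smul_right, norm_smul, mul_div_assoc]
  congr 1
  · congr 1
    push_cast
    field_simp
  · have h1 : (2 * π) ^ 2 * (‖(2 * π)⁻¹‖ * ‖ξ‖) ^ 2 = ‖ξ‖ ^ 2 := by
      rw [mul_pow _ ‖ξ‖, norm_inv, inv_pow, norm_eq_abs, sq_abs, mul_inv_cancel_left₀]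
      positivity
    rw [h1, div_eq_inv_mul, Complex.ofReal_pow, Finset.mul_sum]
    congr 1
    refine Finset.sum_congr rfl fun j _ => ?_
    rw [integral_exp_smul_apply, PiLp.smul_apply, smul_eq_mul]
    push_cast
    field_simp

lemma integrable_exp_mul_fourier (W : 𝓢(EuclideanSpace ℝ ι, ℂ)) (x : EuclideanSpace ℝ ι) :
    Integrable fun η => Complex.exp (2 * π * Complex.I * ⟪x, η⟫) * 𝓕 W η := by
  refine ((𝓕 W).integrable (μ := volume)).norm.mono' ?_ (Filter.Eventually.of_forall fun y => ?_)
  · have := (𝓕 W).continuous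
    exact Continuous.aestronglyMeasurable (by fun_prop)
  · rw [norm_mul, Complex.norm_exp]
    simp

lemma integrable_fourier_integrand {c : ℂ} (hc : c ∈ Complex.slitPlane)
    (F : 𝓢(EuclideanSpace ℝ ι, EuclideanSpace ℂ ι)) (x : EuclideanSpace ℝ ι) :
    Integrable fun ξ : EuclideanSpace ℝ ι => Complex.exp (Complex.I * (⟪x, ξ⟫ : ℂ)) *
        (Complex.I * ∑ j, (ξ j : ℂ) *
          (∫ y, Complex.exp (-Complex.I * (⟪y, ξ⟫ : ℂ)) • F y) j) / (c + (‖ξ‖ : ℂ) ^ 2) := by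
  classical
  simp_rw [fourier_integrand_eq hc]
  exact (integrable_comp_smul_iff volume
    (fun η => Complex.exp (2 * π * Complex.I * ⟪x, η⟫) * 𝓕 (resolvent c F.divergence) η)
    (by positivity)).2 (integrable_exp_mul_fourier _ x)

lemma integral_fourier_integrand [DecidableEq ι] {c : ℂ} (hc : c ∈ Complex.slitPlane)
    (F : 𝓢(EuclideanSpace ℝ ι, EuclideanSpace ℂ ι)) (x : EuclideanSpace ℝ ι) :
    ((((2 * π) ^ Fintype.card ι : ℝ) : ℂ)⁻¹ * ∫ ξ : EuclideanSpace ℝ ι,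
      Complex.exp (Complex.I * (⟪x, ξ⟫ : ℂ)) * (Complex.I * ∑ j, (ξ j : ℂ) *
          (∫ y, Complex.exp (-Complex.I * (⟪y, ξ⟫ : ℂ)) • F y) j) / (c + (‖ξ‖ : ℂ) ^ 2)) =
      resolvent c F.divergence x := by
  simp_rw [fourier_integrand_eq hc]
  rw [Measure.integral_comp_smul volume
    (fun η => Complex.exp (2 * π * Complex.I * ⟪x, η⟫) * 𝓕 (resolvent c F.divergence) η),
    ← eq_integral_fourier, finrank_euclideanSpace, inv_pow, inv_inv,
    abs_of_pos (by positivity), Complex.real_smul, inv_mul_cancel_left₀]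
  exact_mod_cast (by positivity : (2 * π) ^ Fintype.card ι ≠ 0)

lemma mul_resolvent_sub_sum_fderiv [DecidableEq ι] {c : ℂ} (hc : c ∈ Complex.slitPlane)
    (f : 𝓢(EuclideanSpace ℝ ι, ℂ)) (x : EuclideanSpace ℝ ι) :
    c * resolvent c f x - ∑ i, fderiv ℝ (fun y => fderiv ℝ (fun z => resolvent c f z) y
      (EuclideanSpace.single i (1 : ℝ))) x (EuclideanSpace.single i (1 : ℝ)) = f x := by
  have h := DFunLike.congr_fun (smul_resolvent_sub_laplacian hc f) x
  rw [sub_apply, smul_apply, smul_eq_mul, laplacian_eq_sum (EuclideanSpace.basisFun ι ℝ),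
    sum_apply] at h
  simp only [EuclideanSpace.basisFun_apply] at h
  exact h

lemma divergence_neg [DecidableEq ι] (F : 𝓢(EuclideanSpace ℝ ι, EuclideanSpace ℂ ι)) :
    (-F).divergence = -F.divergence := by
  simp [divergence, component, LineDeriv.lineDerivOp_neg]

variable (ι) in
/-- The `L^p` estimates for `(c - Δ)⁻¹` applied to a divergence. -/
lemma exists_LqNorm_resolvent_divergence_le [DecidableEq ι] [Nonempty ι] {p : ℝ} (hp : 1 < p)
    {σ : ℝ} (hσ : σ ∈ Set.Ioo 0 (π / 2)) :
    ∃ M : ℝ, 0 < M ∧ ∀ c : ℂ, c ≠ 0 → |c.arg| < π - σ →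
      ∀ F : 𝓢(EuclideanSpace ℝ ι, EuclideanSpace ℂ ι), ∀ V : 𝓢(EuclideanSpace ℝ ι, ℂ),
        V = resolvent c F.divergence →
        ‖c‖ ^ (1 / 2 : ℝ) * LqNorm volume p (fun x => V x) ≤
          M * LqNorm volume p (fun x => F x) ∧
        LqNorm volume p (fun x => fderiv ℝ V x) ≤ M * LqNorm volume p (fun x => F x) ∧
        ‖c‖ * LqNorm volume p (fun x => V x) ≤ M * LqNorm volume p (fun x => F.divergence x) ∧
        ‖c‖ ^ (1 / 2 : ℝ) * LqNorm volume p (fun x => fderiv ℝ V x) ≤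
          M * LqNorm volume p (fun x => F.divergence x) ∧
        LqNorm volume p (fun x => iteratedFDeriv ℝ 2 V x) ≤
          M * LqNorm volume p (fun x => F.divergence x) := by
  obtain ⟨M, hM, h⟩ := exists_LqNorm_resolvent_le (EuclideanSpace ℝ ι) hp hσ
  set n : ℝ := (Fintype.card ι : ℝ) with hn
  have hn1 : 1 ≤ n := by
    rw [hn]
    exact_mod_cast Fintype.card_pos (α := ι)
  have hs : ∀ k : ι, ‖EuclideanSpace.single k (1 : ℝ)‖ = 1 := fun k => by simp
  refine ⟨n * n * M, by positivity, ?_⟩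
  rintro c hc hcσ F V rfl
  have hcs := Complex.mem_slitPlane_of_abs_arg_lt hc hσ.1.le hcσ
  have hF0 : 0 ≤ LqNorm volume p (fun x => F x) := LqNorm_nonneg
  have hD0 : 0 ≤ LqNorm volume p (fun x => F.divergence x) := LqNorm_nonneg
  have hMF : ∀ j, M * LqNorm volume p (fun x => F.component j x) ≤
      M * LqNorm volume p (fun x => F x) := fun j =>
    mul_le_mul_of_nonneg_left (F.LqNorm_component_le hp.le j) hM.le
  have hM1 : M ≤ n * n * M := by nlinarith [mul_le_mul hn1 hn1 zero_le_one (by linarith)]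
  have hM2 : n * M ≤ n * n * M := by
    rw [mul_assoc]
    exact le_mul_of_one_le_left (by positivity) hn1
  have hV : LqNorm volume p (fun x => resolvent c F.divergence x) ≤
      ∑ j, LqNorm volume p (fun x =>
        ∂_{EuclideanSpace.single j (1 : ℝ)} (resolvent c (F.component j)) x) := by
    simpa using LqNorm_le_sum hp.le (resolvent c F.divergence)
      (fun j => ∂_{EuclideanSpace.single j (1 : ℝ)} (resolvent c (F.component j)))
      (c := fun _ => 1) (fun _ => zero_le_one) fun x => by
        rw [resolvent_divergence hcs, sum_apply]
        simp only [one_mul]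
        exact norm_sum_le _ _
  have hdV : ∀ k : ι, LqNorm volume p (fun x =>
      ∂_{EuclideanSpace.single k (1 : ℝ)} (resolvent c F.divergence) x) ≤
      n * M * LqNorm volume p (fun x => F x) := fun k => by
    have h1 := LqNorm_le_sum hp.le
      (∂_{EuclideanSpace.single k (1 : ℝ)} (resolvent c F.divergence))
      (fun j => ∂_{EuclideanSpace.single k (1 : ℝ)}
        (∂_{EuclideanSpace.single j (1 : ℝ)} (resolvent c (F.component j))))
      (c := fun _ => 1) (fun _ => zero_le_one) fun x => by
        rw [lineDeriv_resolvent_divergence hcs, sum_apply]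
        simp only [one_mul]
        exact norm_sum_le _ _
    refine h1.trans ((Finset.sum_le_sum fun j _ => (one_mul _).trans_le
      (((h c hc hcσ (F.component j)).2 _ _ (hs k) (hs j)).2.trans (hMF j))).trans_eq ?_)
    simp [hn, mul_assoc]
  have hD := h c hc hcσ F.divergence
  refine ⟨?_, ?_, hD.1.trans (by gcongr), ?_, ?_⟩
  · calc _ ≤ ∑ j : ι, ‖c‖ ^ (1 / 2 : ℝ) * LqNorm volume p (fun x =>
          ∂_{EuclideanSpace.single j (1 : ℝ)} (resolvent c (F.component j)) x) := by
          rw [← Finset.mul_sum]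
          gcongr
      _ ≤ ∑ _j : ι, M * LqNorm volume p (fun x => F x) := Finset.sum_le_sum fun j _ =>
          ((h c hc hcσ (F.component j)).2 _ _ (hs j) (hs j)).1.trans (hMF j)
      _ = n * M * LqNorm volume p (fun x => F x) := by simp [hn, mul_assoc]
      _ ≤ _ := by gcongr
  · refine (LqNorm_fderiv_le_sum hp.le _).trans ((Finset.sum_le_sum fun k _ => hdV k).trans_eq ?_)
    simp [hn, mul_assoc]
  · calc _ ≤ ∑ k : ι, ‖c‖ ^ (1 / 2 : ℝ) * LqNorm volume p (fun x =>
          ∂_{EuclideanSpace.single k (1 : ℝ)} (resolvent c F.divergence) x) := by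
          rw [← Finset.mul_sum]
          gcongr
          exact LqNorm_fderiv_le_sum hp.le _
      _ ≤ ∑ _k : ι, M * LqNorm volume p (fun x => F.divergence x) :=
          Finset.sum_le_sum fun k _ => (hD.2 _ _ (hs k) (hs k)).1
      _ = n * M * LqNorm volume p (fun x => F.divergence x) := by simp [hn, mul_assoc]
      _ ≤ _ := by gcongr
  · refine (LqNorm_iteratedFDeriv_two_le_sum hp.le _).trans
      ((Finset.sum_le_sum fun z _ => (hD.2 _ _ (hs z.1) (hs z.2)).2).trans_eq ?_)
    simp [hn, mul_assoc]

end SchwartzMap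

end

end Schwartz

/-- Estimates (3.6): the solution `V` of `ρλV − ΔV = −div F` given by the Fourier formula
is a Schwartz function satisfying `|λ|^{1/2}‖V‖_q + ‖∇V‖_q ≤ C‖F‖_q` and
`|λ|‖V‖_q + |λ|^{1/2}‖∇V‖_q + ‖D²V‖_q ≤ C‖div F‖_q` uniformly in `λ` in the sector. -/
theorem stmt_9 (N : ℕ) (hN : 1 ≤ N) (q : ℝ) (hq : 1 < q) (σ : ℝ)
    (hσ : σ ∈ Set.Ioo 0 (π / 2)) (ρ : ℝ) (hρ : 0 < ρ) :
    ∃ C : ℝ, 0 < C ∧ ∀ lam : ℂ, lam ≠ 0 → |lam.arg| < π - σ →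
      ∀ F : SchwartzMap (EuclideanSpace ℝ (Fin N)) (EuclideanSpace ℂ (Fin N)),
        ∃ V : SchwartzMap (EuclideanSpace ℝ (Fin N)) ℂ,
          (∀ x, Integrable (fun ξ : EuclideanSpace ℝ (Fin N) =>
              Complex.exp (Complex.I * (⟪x, ξ⟫ : ℂ)) *
                (Complex.I * ∑ j : Fin N, (ξ j : ℂ) *
                  (∫ y : EuclideanSpace ℝ (Fin N),
                    Complex.exp (-Complex.I * (⟪y, ξ⟫ : ℂ)) • F y) j) /
                ((ρ : ℂ) * lam + (‖ξ‖ : ℂ) ^ 2))) ∧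
          (∀ x, V x = -((((2 * π) ^ N : ℝ) : ℂ)⁻¹ *
              ∫ ξ : EuclideanSpace ℝ (Fin N),
                Complex.exp (Complex.I * (⟪x, ξ⟫ : ℂ)) *
                  (Complex.I * ∑ j : Fin N, (ξ j : ℂ) *
                    (∫ y : EuclideanSpace ℝ (Fin N),
                      Complex.exp (-Complex.I * (⟪y, ξ⟫ : ℂ)) • F y) j) /
                  ((ρ : ℂ) * lam + (‖ξ‖ : ℂ) ^ 2))) ∧
          (∀ x, (ρ : ℂ) * lam * V x -
              (∑ i : Fin N, fderiv ℝ
                (fun y => fderiv ℝ (fun z => V z) y (EuclideanSpace.single i 1)) x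
                (EuclideanSpace.single i 1)) =
            -∑ j : Fin N, fderiv ℝ (fun y => F y j) x (EuclideanSpace.single j 1)) ∧
          ‖lam‖ ^ ((1 : ℝ) / 2) * LqNorm volume q (fun x => V x) +
              LqNorm volume q (fun x => fderiv ℝ (fun y => V y) x) ≤
            C * LqNorm volume q (fun x => F x) ∧
          ‖lam‖ * LqNorm volume q (fun x => V x) +
              ‖lam‖ ^ ((1 : ℝ) / 2) *
                LqNorm volume q (fun x => fderiv ℝ (fun y => V y) x) +
              LqNorm volume q (fun x => iteratedFDeriv ℝ 2 (fun y => V y) x) ≤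
            C * LqNorm volume q (fun x =>
              ∑ j : Fin N, fderiv ℝ (fun y => F y j) x (EuclideanSpace.single j 1)) := by
  have : Nonempty (Fin N) := ⟨⟨0, hN⟩⟩
  obtain ⟨M, hM, h⟩ := SchwartzMap.exists_LqNorm_resolvent_divergence_le (Fin N) hq hσ
  refine ⟨(ρ⁻¹ + (ρ⁻¹) ^ (1 / 2 : ℝ) + 1) * M, by positivity, fun lam hlam harg F => ?_⟩
  have hc : (ρ : ℂ) * lam ≠ 0 := mul_ne_zero (by exact_mod_cast hρ.ne') hlam
  have hcσ : |((ρ : ℂ) * lam).arg| < π - σ := by rwa [Complex.arg_real_mul _ hρ]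
  have hcs := Complex.mem_slitPlane_of_abs_arg_lt hc hσ.1.le hcσ
  have hl : ‖lam‖ = ρ⁻¹ * ‖(ρ : ℂ) * lam‖ := by
    rw [norm_mul, Complex.norm_of_nonneg hρ.le, inv_mul_cancel_left₀ hρ.ne']
  have hl2 : ‖lam‖ ^ (1 / 2 : ℝ) = (ρ⁻¹) ^ (1 / 2 : ℝ) * ‖(ρ : ℂ) * lam‖ ^ (1 / 2 : ℝ) := by
    rw [hl, mul_rpow (by positivity) (by positivity)]
  have hneg : SchwartzMap.resolvent ((ρ : ℂ) * lam) (-F).divergence =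
      -SchwartzMap.resolvent ((ρ : ℂ) * lam) F.divergence := by
    rw [SchwartzMap.divergence_neg, map_neg]
  refine ⟨SchwartzMap.resolvent ((ρ : ℂ) * lam) (-F).divergence,
    SchwartzMap.integrable_fourier_integrand hcs F, fun x => ?_, fun x => ?_, ?_⟩
  · have h1 := SchwartzMap.integral_fourier_integrand hcs F x
    rw [Fintype.card_fin] at h1
    rw [h1, hneg, neg_apply]
  · rw [SchwartzMap.mul_resolvent_sub_sum_fderiv hcs, SchwartzMap.divergence_neg,
      neg_apply, SchwartzMap.divergence_apply]
  obtain ⟨h1, h2, h3, h4, h5⟩ := h _ hc hcσ (-F) _ rfl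
  have hF : LqNorm volume q (fun x => (-F) x) = LqNorm volume q (fun x => F x) := by
    simp [LqNorm]
  have hD : LqNorm volume q (fun x => (-F).divergence x) = LqNorm volume q (fun x =>
      ∑ j : Fin N, fderiv ℝ (fun y => F y j) x (EuclideanSpace.single j 1)) := by
    simp only [LqNorm, SchwartzMap.divergence_neg, neg_apply, norm_neg,
      SchwartzMap.divergence_apply]
  rw [hF] at h1 h2
  rw [hD] at h3 h4 h5
  have hF0 := LqNorm_nonneg (μ := volume) (p := q) (f := fun x => F x)
  have hs : 0 < (ρ⁻¹) ^ (1 / 2 : ℝ) := by positivity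
  have hr : 0 < ρ⁻¹ := by positivity
  rw [hl2]
  refine ⟨?_, ?_⟩
  · have h1' := mul_le_mul_of_nonneg_left h1 hs.le
    have h6 := mul_nonneg hr.le (mul_nonneg hM.le hF0)
    linarith
  · rw [hl]
    have h3' := mul_le_mul_of_nonneg_left h3 hr.le
    have h4' := mul_le_mul_of_nonneg_left h4 hs.le
    linarith
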